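/- arXiv:2401.06352 — 6 statements merged into one kernel-verified Lean document; each statement's English description precedes it below -/
import Mathlib

section
/- Under the hypotheses of the over-approximation theorem (f continuous, Lipschitz in x uniformly in (s,u), U compact nonempty; v̲ : [0,T] × ℝⁿ → ℝ continuous, a viscosity subsolution of −v_t + H(t,x,∇v) = 0 with H(t,x,p) = max_{u∈U} ⟨−p, f(t,x,u)⟩ on Ω = {(t,x) ∈ (0,T) × ℝⁿ | v̲(t,x) > 0}, with v̲(T,·) = g̲ and g̲ ≤ 0 on 𝒳 = {g ≤ 0}), define 𝒢̄(t) = {x ∈ ℝⁿ | v̲(t,x) ≤ 0}. Then for any t₁, t₂ ∈ [0,T] with t₁ ≤ t₂, any x̄ ∉ 𝒢̄(t₁), and any measurable control u : [t₁,t₂] → U, one has φ(t₂; t₁, x̄, u) ∉ 𝒢̄(t₂). -/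
open scoped RealInnerProductSpace
open Set

noncomputable section

/-- A measurable control valued in `U` on `[t, T]`. -/
def Admissible {α : Type*} [MeasurableSpace α] (U : Set α) (t T : ℝ) (u : ℝ → α) : Prop :=
  Measurable u ∧ ∀ s ∈ Set.Icc t T, u s ∈ U

/-- `X` is the (absolutely continuous) trajectory of `ẋ(s) = f(s, x(s), u(s))` on `[t, T]`
with `X t = x`, written in integral form. -/
def IsTraj {n m : ℕ} (f : ℝ → EuclideanSpace ℝ (Fin n) → (Fin m → ℝ) → EuclideanSpace ℝ (Fin n))
    (t T : ℝ) (x : EuclideanSpace ℝ (Fin n)) (u : ℝ → (Fin m → ℝ))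
    (X : ℝ → EuclideanSpace ℝ (Fin n)) : Prop :=
  ContinuousOn X (Set.Icc t T) ∧
    ∀ s ∈ Set.Icc t T, X s = x + ∫ r in t..s, f r (X r) (u r)

/-- The backwards reachable set at time `t` of the target `{g ≤ 0}` at time `T`. -/
def Reach {n m : ℕ} (U : Set (Fin m → ℝ))
    (f : ℝ → EuclideanSpace ℝ (Fin n) → (Fin m → ℝ) → EuclideanSpace ℝ (Fin n))
    (g : EuclideanSpace ℝ (Fin n) → ℝ) (T t : ℝ) : Set (EuclideanSpace ℝ (Fin n)) :=
  {x | ∃ u X, Admissible U t T u ∧ IsTraj f t T x u X ∧ g (X T) ≤ 0}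

/-- `(pt, px)` is a Fréchet supergradient of `w` at `(t₀, x₀)`:
the limsup as `(t,x) → (t₀,x₀)` of
`[w(t,x) − w(t₀,x₀) − ⟨(pt,px), (t,x) − (t₀,x₀)⟩]/‖(t,x) − (t₀,x₀)‖` is nonpositive. -/
def IsSupGrad {n : ℕ} (w : ℝ → EuclideanSpace ℝ (Fin n) → ℝ) (t₀ : ℝ)
    (x₀ : EuclideanSpace ℝ (Fin n)) (pt : ℝ) (px : EuclideanSpace ℝ (Fin n)) : Prop :=
  ∀ ε : ℝ, 0 < ε →
    ∀ᶠ z : ℝ × EuclideanSpace ℝ (Fin n) in nhdsWithin (t₀, x₀) {(t₀, x₀)}ᶜ,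
      w z.1 z.2 - w t₀ x₀ - (pt * (z.1 - t₀) + ⟪px, z.2 - x₀⟫) ≤ ε * ‖(z.1 - t₀, z.2 - x₀)‖

lemma isSupGrad_of_le {n : ℕ} (w : ℝ → EuclideanSpace ℝ (Fin n) → ℝ) (t₀ : ℝ)
    (x₀ : EuclideanSpace ℝ (Fin n)) (pt : ℝ) (px : EuclideanSpace ℝ (Fin n))
    (Φ : ℝ × EuclideanSpace ℝ (Fin n) → ℝ)
    (D : ℝ × EuclideanSpace ℝ (Fin n) →L[ℝ] ℝ)
    (hD : HasFDerivAt Φ D (t₀, x₀))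
    (hDe : ∀ τ ξ, D (τ, ξ) = pt * τ + ⟪px, ξ⟫)
    (hle : ∀ᶠ z in nhds (t₀, x₀), w z.1 z.2 - w t₀ x₀ ≤ Φ z - Φ (t₀, x₀)) :
    IsSupGrad w t₀ x₀ pt px := by
  intro ε hε
  have h1 := hD.isLittleO.def hε
  refine Filter.Eventually.filter_mono nhdsWithin_le_nhds ?_
  filter_upwards [h1, hle] with z hz1 hz2
  have e : z - (t₀, x₀) = (z.1 - t₀, z.2 - x₀) := rfl
  rw [e, hDe, Real.norm_eq_abs] at hz1
  have := (abs_le.1 hz1).2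
  linarith

lemma exists_psi (a c b W B : ℝ) (hac : a < c) (hcb : c < b) (hW : 0 < W) :
    ∃ (ψ ψ' : ℝ → ℝ) (l : ℝ), 0 < l ∧ (∀ t, HasDerivAt ψ (ψ' t) t) ∧
      (∀ t ≤ b, ψ' t ≤ -l) ∧ (∀ t, 0 < ψ t) ∧ ψ c = W ∧ ψ c + B < ψ a := by
  obtain ⟨k, hk0, hk⟩ : ∃ k : ℝ, 0 < k ∧ B / W < k * (c - a) := by
    refine ⟨(|B| / W + 1) / (c - a), ?_, ?_⟩
    · have : 0 < c - a := by linarith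
      positivity
    · rw [div_mul_cancel₀ _ (by linarith)]
      have : B / W ≤ |B| / W := by gcongr; exact le_abs_self B
      linarith
  refine ⟨fun t => W * Real.exp (-k * (t - c)), fun t => W * (Real.exp (-k * (t - c)) * (-k * 1)),
    W * (Real.exp (-k * (b - c)) * k), by positivity, ?_, ?_, ?_, ?_, ?_⟩
  · intro t
    exact ((((hasDerivAt_id t).sub_const c).const_mul (-k)).exp).const_mul W
  · intro t ht
    have : Real.exp (-k * (b - c)) ≤ Real.exp (-k * (t - c)) := by
      apply Real.exp_le_exp.2
      nlinarith
    have : W * (Real.exp (-k * (b - c)) * k) ≤ W * (Real.exp (-k * (t - c)) * k) := by gcongr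
    linarith
  · intro t; positivity
  · simp
  · have h1 := Real.add_one_le_exp (-k * (a - c))
    have h2 : W * (B / W) = B := by field_simp
    have : W * (B / W) < W * (k * (c - a)) := by gcongr
    have : W * (-k * (a - c) + 1) ≤ W * Real.exp (-k * (a - c)) := by gcongr
    simp only [sub_self, mul_zero, Real.exp_zero, mul_one]
    linarith

lemma exists_approx {n m : ℕ} (U : Set (Fin m → ℝ)) (hUc : IsCompact U)
    (f : ℝ → EuclideanSpace ℝ (Fin n) → (Fin m → ℝ) → EuclideanSpace ℝ (Fin n))
    (a b b' : ℝ) (hb' : b' < b)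
    (hfc : ContinuousOn
      (fun z : ℝ × EuclideanSpace ℝ (Fin n) × (Fin m → ℝ) => f z.1 z.2.1 z.2.2)
      (Set.Icc a b ×ˢ (Set.univ : Set (EuclideanSpace ℝ (Fin n))) ×ˢ U))
    (x : EuclideanSpace ℝ (Fin n)) (u : ℝ → (Fin m → ℝ))
    (X : ℝ → EuclideanSpace ℝ (Fin n)) (hu : Admissible U a b u) (hX : IsTraj f a b x u X)
    (η : ℝ) (hη : 0 < η) (hab : a ≤ b) :
    ∃ Y q : ℝ → EuclideanSpace ℝ (Fin n), (∀ t, HasDerivAt Y (q t) t) ∧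
      ∀ t ∈ Set.Icc a b', ‖Y t - X t‖ ≤ η ∧
        ∀ (p : EuclideanSpace ℝ (Fin n)) (C : ℝ), (∀ w ∈ U, C ≤ ⟪p, f t (X t) w⟫) →
          C - ‖p‖ * η ≤ ⟪p, q t⟫ := by
  obtain ⟨hXc, hXi⟩ := hX
  obtain ⟨hum, huU⟩ := hu
  -- F (s,w) = f s (X s) w
  have hF : ContinuousOn (fun z : ℝ × (Fin m → ℝ) => f z.1 (X z.1) z.2) (Set.Icc a b ×ˢ U) := by
    refine hfc.comp (f := fun z : ℝ × (Fin m → ℝ) => (z.1, X z.1, z.2)) ?_ ?_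
    · refine continuousOn_fst.prodMk (ContinuousOn.prodMk ?_ continuousOn_snd)
      exact hXc.comp continuousOn_fst (fun z hz => hz.1)
    · intro z hz
      exact ⟨hz.1, Set.mem_univ _, hz.2⟩
  have hK : IsCompact (Set.Icc a b ×ˢ U) := isCompact_Icc.prod hUc
  have hFu := hK.uniformContinuousOn_of_continuous hF
  have hXu := isCompact_Icc.uniformContinuousOn_of_continuous hXc
  rw [Metric.uniformContinuousOn_iff] at hFu hXu
  obtain ⟨d1, hd1, hF1⟩ := hFu η hη
  obtain ⟨d2, hd2, hX1⟩ := hXu η hη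
  obtain ⟨M, hM⟩ := hK.exists_bound_of_continuousOn hF
  -- integrability
  have hint : MeasureTheory.IntegrableOn (fun r => f r (X r) (u r)) (Set.Icc a b) := by
    refine MeasureTheory.Integrable.of_bound (C := M) ?_ ?_
    · have hmeas : Measurable (fun r : Set.Icc a b => f r (X r) (u r)) := by
        have h1 : Continuous (fun z : (Set.Icc a b ×ˢ U : Set (ℝ × (Fin m → ℝ))) =>
            f z.1.1 (X z.1.1) z.1.2) := hF.restrict
        have h2 : Measurable (fun r : Set.Icc a b =>
            (⟨(r.1, u r.1), ⟨r.2, huU r.1 r.2⟩⟩ : (Set.Icc a b ×ˢ U : Set (ℝ × (Fin m → ℝ))))) := by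
          refine Measurable.subtype_mk ?_
          exact measurable_subtype_coe.prodMk (hum.comp measurable_subtype_coe)
        exact h1.measurable.comp h2
      exact AEMeasurable.aestronglyMeasurable
        ((aemeasurable_restrict_iff_comap_subtype (f := fun r => f r (X r) (u r))
          measurableSet_Icc).2 (Measurable.aemeasurable hmeas))
    · filter_upwards [MeasureTheory.ae_restrict_mem measurableSet_Icc] with r hr
      exact hM (r, u r) ⟨hr, huU r hr⟩
  have hII : ∀ s ∈ Set.Icc a b, ∀ t ∈ Set.Icc a b,
      IntervalIntegrable (fun r => f r (X r) (u r)) MeasureTheory.volume s t := by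
    intro s hs t ht
    refine MeasureTheory.IntegrableOn.intervalIntegrable (hint.mono_set ?_)
    exact Set.uIcc_subset_Icc hs ht
  obtain ⟨h, hh0, hhb, hh1, hh2⟩ : ∃ h : ℝ, 0 < h ∧ h < b - b' ∧ h < d1 ∧ h < d2 := by
    have : 0 < b - b' := by linarith
    refine ⟨min (b - b') (min d1 d2) / 2, by positivity, ?_, ?_, ?_⟩
    all_goals
      have h0 : 0 < min (b - b') (min d1 d2) := by positivity
      have e1 := min_le_left (b - b') (min d1 d2)
      have e2 := min_le_right (b - b') (min d1 d2)
      have e3 := min_le_left d1 d2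
      have e4 := min_le_right d1 d2
      linarith
  let Z : ℝ → EuclideanSpace ℝ (Fin n) := Set.IccExtend hab ((Set.Icc a b).restrict X)
  have hZc : Continuous Z := (continuousOn_iff_continuous_restrict.1 hXc).Icc_extend'
  have hZX : ∀ t ∈ Set.Icc a b, Z t = X t := fun t ht => by
    simp only [Z]; rw [Set.IccExtend_of_mem _ _ ht]; rfl
  have hZi : ∀ s t, IntervalIntegrable Z MeasureTheory.volume s t :=
    fun s t => hZc.intervalIntegrable s t
  refine ⟨fun t => h⁻¹ • ∫ s in t..(t + h), Z s, fun t => h⁻¹ • (Z (t + h) - Z t), ?_, ?_⟩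
  · intro t
    have e : (fun t => h⁻¹ • ∫ s in t..(t + h), Z s) =
        fun t => h⁻¹ • ((∫ s in (0 : ℝ)..(t + h), Z s) - ∫ s in (0 : ℝ)..t, Z s) := by
      funext t
      rw [intervalIntegral.integral_interval_sub_left (hZi _ _) (hZi _ _)]
    rw [e]
    have h1 : ∀ t, HasDerivAt (fun t => ∫ s in (0 : ℝ)..t, Z s) (Z t) t := fun t =>
      intervalIntegral.integral_hasDerivAt_right (hZi _ _)
        hZc.stronglyMeasurable.stronglyMeasurableAtFilter hZc.continuousAt
    exact (((h1 (t + h)).comp_add_const t h).sub (h1 t)).const_smul h⁻¹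
  · intro t ht
    have hta : t ∈ Set.Icc a b := ⟨ht.1, by linarith [ht.2]⟩
    have hth : t + h ∈ Set.Icc a b := ⟨by linarith [ht.1], by linarith [ht.2]⟩
    have hsub : ∀ s ∈ Set.Icc t (t + h), s ∈ Set.Icc a b := fun s hs =>
      ⟨hta.1.trans hs.1, hs.2.trans hth.2⟩
    constructor
    · have e : h⁻¹ • (∫ s in t..(t + h), Z s) - X t = h⁻¹ • ∫ s in t..(t + h), (Z s - X t) := by
        rw [intervalIntegral.integral_sub (hZi _ _) intervalIntegrable_const, smul_sub]
        simp [hh0.ne']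
      simp only []
      rw [e, norm_smul]
      have h2 : ‖∫ s in t..(t + h), (Z s - X t)‖ ≤ η * |t + h - t| := by
        refine intervalIntegral.norm_integral_le_of_norm_le_const ?_
        intro s hs
        rw [Set.uIoc_of_le (by linarith)] at hs
        have hs' : s ∈ Set.Icc t (t + h) := ⟨hs.1.le, hs.2⟩
        rw [hZX s (hsub s hs'), ← dist_eq_norm]
        refine (hX1 s (hsub s hs') t hta ?_).le
        rw [Real.dist_eq, abs_lt]
        constructor <;> linarith [hs'.1, hs'.2]
      have e3 : |t + h - t| = h := by rw [add_sub_cancel_left, abs_of_pos hh0]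
      rw [e3] at h2
      rw [norm_inv, Real.norm_eq_abs, abs_of_pos hh0, inv_mul_le_iff₀ hh0]
      linarith
    · intro p C hC
      simp only []
      rw [hZX _ hth, hZX _ hta, hXi _ hth, hXi _ hta, add_sub_add_left_eq_sub,
        intervalIntegral.integral_interval_sub_left (hII _ ⟨le_rfl, hab⟩ _ hth)
          (hII _ ⟨le_rfl, hab⟩ _ hta), inner_smul_right]
      have e1 : ⟪p, ∫ r in t..(t + h), f r (X r) (u r)⟫ =
          ∫ r in t..(t + h), ⟪p, f r (X r) (u r)⟫ := by
        have := ContinuousLinearMap.intervalIntegral_comp_comm (innerSL ℝ p)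
          (hII _ hta _ hth)
        simpa using this.symm
      rw [e1, le_inv_mul_iff₀ hh0]
      have e2 : h * (C - ‖p‖ * η) = ∫ r in t..(t + h), (C - ‖p‖ * η) := by
        rw [intervalIntegral.integral_const, smul_eq_mul, add_sub_cancel_left]
      rw [e2]
      refine intervalIntegral.integral_mono_on (by linarith) intervalIntegrable_const ?_ ?_
      · have := (hII _ hta _ hth)
        constructor
        · exact this.1.const_inner p
        · exact this.2.const_inner p
      · intro s hs
        have hsb := hsub s hs
        have h3 := hC (u s) (huU s hsb)
        have h4 : ‖f s (X s) (u s) - f t (X t) (u s)‖ ≤ η := by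
          rw [← dist_eq_norm]
          refine (hF1 (s, u s) ⟨hsb, huU s hsb⟩ (t, u s) ⟨hta, huU s hsb⟩ ?_).le
          rw [Prod.dist_eq, dist_self, max_eq_left dist_nonneg, Real.dist_eq, abs_lt]
          constructor <;> linarith [hs.1, hs.2]
        have h5 := abs_real_inner_le_norm p (f s (X s) (u s) - f t (X t) (u s))
        rw [inner_sub_right] at h5
        have h6 := (abs_le.1 h5).1
        have h7 : ‖p‖ * ‖f s (X s) (u s) - f t (X t) (u s)‖ ≤ ‖p‖ * η := by gcongr
        linarith

lemma core {n m : ℕ} (T : ℝ)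
    (U : Set (Fin m → ℝ))
    (f : ℝ → EuclideanSpace ℝ (Fin n) → (Fin m → ℝ) → EuclideanSpace ℝ (Fin n))
    (L : ℝ) (hL : 0 ≤ L)
    (hfl : ∀ s ∈ Set.Icc (0 : ℝ) T, ∀ w ∈ U, ∀ x y : EuclideanSpace ℝ (Fin n),
      ‖f s x w - f s y w‖ ≤ L * ‖x - y‖)
    (v : ℝ → EuclideanSpace ℝ (Fin n) → ℝ)
    (hvc : ContinuousOn (fun z : ℝ × EuclideanSpace ℝ (Fin n) => v z.1 z.2)
      (Set.Icc 0 T ×ˢ (Set.univ : Set (EuclideanSpace ℝ (Fin n)))))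
    (hsub : ∀ t₀ ∈ Set.Ioo (0 : ℝ) T, ∀ x₀, 0 < v t₀ x₀ →
      ∀ pt px, IsSupGrad v t₀ x₀ pt px → ∀ w ∈ U, -pt ≤ ⟪px, f t₀ x₀ w⟫)
    (a c b : ℝ) (ha : 0 ≤ a) (hac : a < c) (hcb : c < b) (hbT : b ≤ T)
    (X : ℝ → EuclideanSpace ℝ (Fin n)) (hXc : ContinuousOn X (Set.Icc a b))
    (W : ℝ) (hW : 0 < W) (hcW : 4 * W ≤ v c (X c)) (hbW : v b (X b) ≤ W)
    (happ : ∀ η : ℝ, 0 < η → ∃ Y q : ℝ → EuclideanSpace ℝ (Fin n),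
      (∀ t, HasDerivAt Y (q t) t) ∧
      ∀ t ∈ Set.Icc a b, ‖Y t - X t‖ ≤ η ∧
        ∀ (p : EuclideanSpace ℝ (Fin n)) (C : ℝ), (∀ w ∈ U, C ≤ ⟪p, f t (X t) w⟫) →
          C - ‖p‖ * η ≤ ⟪p, q t⟫) : False := by
  obtain ⟨R, hR⟩ := isCompact_Icc.exists_bound_of_continuousOn hXc
  have hK : IsCompact (Set.Icc a b ×ˢ Metric.closedBall (0 : EuclideanSpace ℝ (Fin n)) (R + 2)) :=
    isCompact_Icc.prod (isCompact_closedBall _ _)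
  have hvK := hvc.mono (show (Set.Icc a b ×ˢ
      Metric.closedBall (0 : EuclideanSpace ℝ (Fin n)) (R + 2)) ⊆ _ from
    fun z hz => ⟨⟨ha.trans hz.1.1, hz.1.2.trans hbT⟩, Set.mem_univ _⟩)
  have hvu := hK.uniformContinuousOn_of_continuous hvK
  rw [Metric.uniformContinuousOn_iff] at hvu
  obtain ⟨B, hB⟩ := hK.exists_bound_of_continuousOn hvK
  obtain ⟨ψ, ψ', l, hl, hψd, hψl, hψ0, hψc, hψa⟩ := exists_psi a c b W (2 * B) hac hcb hW
  obtain ⟨e, he0, heW, hel⟩ : ∃ e : ℝ, 0 < e ∧ e ≤ W / 4 ∧ 2 * L * e ≤ l / 2 := by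
    refine ⟨min (W / 4) (l / (4 * (L + 1))), by positivity, min_le_left _ _, ?_⟩
    have h1 := min_le_right (W / 4) (l / (4 * (L + 1)))
    calc 2 * L * min (W / 4) (l / (4 * (L + 1))) ≤ 2 * (L + 1) * (l / (4 * (L + 1))) := by
          gcongr; linarith
      _ = l / 2 := by field_simp; norm_num
  obtain ⟨d, hd, hvd⟩ := hvu e he0
  have hb0 : b ∈ Set.Icc a b := ⟨by linarith, le_rfl⟩
  have hc0 : c ∈ Set.Icc a b := ⟨hac.le, hcb.le⟩
  have hB0 : 0 ≤ B := by
    have := hB (b, X b) ⟨hb0, by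
      rw [mem_closedBall_zero_iff]; linarith [hR b hb0]⟩
    exact (norm_nonneg _).trans this
  obtain ⟨r, hr0, hr1, hrd⟩ : ∃ r : ℝ, 0 < r ∧ r < 1 ∧ r ≤ d / 2 :=
    ⟨min (1/2) (d / 2), by positivity, (min_le_left _ _).trans_lt (by norm_num), min_le_right _ _⟩
  obtain ⟨α, hα0, hα⟩ : ∃ α : ℝ, 0 < α ∧ 2 * B < α * r ^ 2 :=
    ⟨(2 * B + 1) / r ^ 2, by positivity, by rw [div_mul_cancel₀ _ (by positivity)]; linarith⟩
  obtain ⟨η, hη0, hη1, hηd, hηl⟩ : ∃ η : ℝ, 0 < η ∧ η ≤ 1 ∧ η < d / 2 ∧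
      2 * α * (L + 1) * η < l / 2 := by
    refine ⟨min 1 (min (d / 4) (l / (8 * α * (L + 1)))), by positivity, min_le_left _ _, ?_, ?_⟩
    · refine ((min_le_right _ _).trans (min_le_left _ _)).trans_lt (by linarith)
    · have h1 := (min_le_right 1 (min (d / 4) (l / (8 * α * (L + 1))))).trans (min_le_right _ _)
      calc _ ≤ 2 * α * (L + 1) * (l / (8 * α * (L + 1))) := by gcongr
        _ = l / 4 := by field_simp; norm_num
        _ < l / 2 := by linarith
  obtain ⟨Y, q, hYd, hY⟩ := happ η hη0
  have hYc : Continuous Y := continuous_iff_continuousAt.2 fun t => (hYd t).continuousAt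
  have hmem : ∀ t ∈ Set.Icc a b, ∀ y : EuclideanSpace ℝ (Fin n), ‖y‖ ≤ 1 →
      (t, Y t + y) ∈ Set.Icc a b ×ˢ
        Metric.closedBall (0 : EuclideanSpace ℝ (Fin n)) (R + 2) := by
    intro t ht y hy
    refine ⟨ht, ?_⟩
    rw [mem_closedBall_zero_iff]
    have h1 := (hY t ht).1
    have h2 := hR t ht
    have h3 : Y t + y = (Y t - X t) + X t + y := by abel
    change ‖Y t + y‖ ≤ R + 2
    rw [h3]
    refine (norm_add₃_le).trans ?_
    linarith
  have hXmem : ∀ t ∈ Set.Icc a b, (t, X t) ∈ Set.Icc a b ×ˢ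
        Metric.closedBall (0 : EuclideanSpace ℝ (Fin n)) (R + 2) := by
    intro t ht
    refine ⟨ht, ?_⟩
    rw [mem_closedBall_zero_iff]
    linarith [hR t ht]
  -- the maximum
  have hK2 : IsCompact (Set.Icc a b ×ˢ Metric.closedBall (0 : EuclideanSpace ℝ (Fin n)) 1) :=
    isCompact_Icc.prod (isCompact_closedBall _ _)
  have hψcont : Continuous ψ := continuous_iff_continuousAt.2 fun t => (hψd t).continuousAt
  have hG : ContinuousOn (fun z : ℝ × EuclideanSpace ℝ (Fin n) =>
      v z.1 (Y z.1 + z.2) - α * ‖z.2‖ ^ 2 - ψ z.1)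
      (Set.Icc a b ×ˢ Metric.closedBall (0 : EuclideanSpace ℝ (Fin n)) 1) := by
    refine ContinuousOn.sub (ContinuousOn.sub ?_ ?_) ?_
    · refine hvK.comp (f := fun z : ℝ × EuclideanSpace ℝ (Fin n) => (z.1, Y z.1 + z.2)) ?_ ?_
      · exact Continuous.continuousOn (by fun_prop)
      · intro z hz
        exact hmem z.1 hz.1 z.2 (by simpa using hz.2)
    · exact Continuous.continuousOn (by fun_prop)
    · exact Continuous.continuousOn (by fun_prop)
  obtain ⟨⟨t₀, y₀⟩, hz0, hmax⟩ := hK2.exists_isMaxOn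
    ⟨(c, 0), hc0, by simp⟩ hG
  have hmax' : ∀ t ∈ Set.Icc a b, ∀ y : EuclideanSpace ℝ (Fin n), ‖y‖ ≤ 1 →
      v t (Y t + y) - α * ‖y‖ ^ 2 - ψ t ≤ v t₀ (Y t₀ + y₀) - α * ‖y₀‖ ^ 2 - ψ t₀ := by
    intro t ht y hy
    exact hmax (show (t, y) ∈ _ from ⟨ht, by simpa using hy⟩)
  obtain ⟨ht0, hy0⟩ := hz0
  replace hy0 : ‖y₀‖ ≤ 1 := by simpa using hy0
  replace ht0 : t₀ ∈ Set.Icc a b := ht0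
  have hm0 := hmax' t₀ ht0 0 (by simp)
  have hmc := hmax' c hc0 0 (by simp)
  simp only [add_zero, norm_zero, ne_eq, OfNat.ofNat_ne_zero, not_false_eq_true, zero_pow,
    mul_zero, sub_zero] at hm0 hmc
  have hYm : ∀ t ∈ Set.Icc a b, (t, Y t) ∈ Set.Icc a b ×ˢ
        Metric.closedBall (0 : EuclideanSpace ℝ (Fin n)) (R + 2) := by
    intro t ht
    simpa using hmem t ht 0 (by simp)
  have hb1 := abs_le.1 (hB _ (hmem t₀ ht0 y₀ hy0))
  have hb2 := abs_le.1 (hB _ (hYm t₀ ht0))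
  have hb3 := abs_le.1 (hB _ (hYm c hc0))
  simp only [] at hb1 hb2 hb3
  have hyr : ‖y₀‖ < r := by
    by_contra hcon
    push Not at hcon
    have : α * r ^ 2 ≤ α * ‖y₀‖ ^ 2 := by gcongr
    linarith [hb1.2, hb2.1]
  have hye : α * ‖y₀‖ ^ 2 ≤ e := by
    have h1 := hvd _ (hmem t₀ ht0 y₀ hy0) _ (hYm t₀ ht0) (by
      rw [Prod.dist_eq, dist_self, max_eq_right dist_nonneg, dist_eq_norm]
      simp only [add_sub_cancel_left]
      linarith)
    rw [Real.dist_eq, abs_lt] at h1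
    linarith [h1.2]
  have hvc' : 4 * W - e ≤ v c (Y c) := by
    have h1 := hvd _ (hYm c hc0) _ (hXmem c hc0) (by
      rw [Prod.dist_eq, dist_self, max_eq_right dist_nonneg, dist_eq_norm]
      have := (hY c hc0).1
      simp only []
      linarith)
    rw [Real.dist_eq, abs_lt] at h1
    simp only [] at h1
    linarith [h1.1]
  have hsq : 0 ≤ α * ‖y₀‖ ^ 2 := by positivity
  have hta : a < t₀ := by
    refine lt_of_le_of_ne ht0.1 ?_
    rintro rfl
    linarith [hb1.2, hb3.1]
  have htb : t₀ < b := by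
    refine lt_of_le_of_ne ht0.2 ?_
    rintro rfl
    have h1 := hvd _ (hmem t₀ ht0 y₀ hy0) _ (hXmem t₀ ht0) (by
      rw [Prod.dist_eq, dist_self, max_eq_right dist_nonneg, dist_eq_norm]
      have h2 := (hY t₀ ht0).1
      have h3 := norm_add_le (Y t₀ - X t₀) y₀
      have h4 : Y t₀ + y₀ - X t₀ = Y t₀ - X t₀ + y₀ := by abel
      simp only []
      rw [h4]
      linarith)
    rw [Real.dist_eq, abs_lt] at h1
    simp only [] at h1
    linarith [h1.2, hψ0 t₀]
  have hpos : 0 < v t₀ (Y t₀ + y₀) := by linarith [hψ0 t₀]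
  -- the supergradient
  have hgrad : IsSupGrad v t₀ (Y t₀ + y₀) (ψ' t₀ - 2 * α * ⟪y₀, q t₀⟫) ((2 * α) • y₀) := by
    have hd1 : HasFDerivAt (fun z : ℝ × EuclideanSpace ℝ (Fin n) => z.2 - Y z.1)
        (ContinuousLinearMap.snd ℝ ℝ (EuclideanSpace ℝ (Fin n)) -
          (ContinuousLinearMap.toSpanSingleton ℝ (q t₀)).comp
            (ContinuousLinearMap.fst ℝ ℝ (EuclideanSpace ℝ (Fin n)))) (t₀, Y t₀ + y₀) := by
      refine hasFDerivAt_snd.sub ?_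
      exact HasFDerivAt.comp (g := Y) (f := Prod.fst) (t₀, Y t₀ + y₀)
        (hYd t₀).hasFDerivAt hasFDerivAt_fst
    have hd2 := (hd1.norm_sq).const_mul α
    have hd3 : HasFDerivAt (fun z : ℝ × EuclideanSpace ℝ (Fin n) => ψ z.1)
        ((ContinuousLinearMap.toSpanSingleton ℝ (ψ' t₀)).comp
            (ContinuousLinearMap.fst ℝ ℝ (EuclideanSpace ℝ (Fin n)))) (t₀, Y t₀ + y₀) :=
      HasFDerivAt.comp (g := ψ) (f := Prod.fst) (t₀, Y t₀ + y₀)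
        (hψd t₀).hasFDerivAt hasFDerivAt_fst
    refine isSupGrad_of_le v t₀ (Y t₀ + y₀) _ _ _ _ (hd2.add hd3) ?_ ?_
    · intro τ ξ
      simp [inner_sub_right, inner_smul_right, inner_smul_left]
      ring
    · have hn1 : ∀ᶠ z : ℝ × EuclideanSpace ℝ (Fin n) in nhds (t₀, Y t₀ + y₀),
          z.1 ∈ Set.Ioo a b :=
        continuous_fst.continuousAt.eventually (isOpen_Ioo.mem_nhds ⟨hta, htb⟩)
      have hn2 : ∀ᶠ z : ℝ × EuclideanSpace ℝ (Fin n) in nhds (t₀, Y t₀ + y₀),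
          ‖z.2 - Y z.1‖ < 1 := by
        have hcc : Continuous (fun z : ℝ × EuclideanSpace ℝ (Fin n) => ‖z.2 - Y z.1‖) := by
          fun_prop
        refine hcc.continuousAt.eventually_lt continuousAt_const ?_
        simp only [add_sub_cancel_left]
        linarith
      filter_upwards [hn1, hn2] with z hz1 hz2
      have := hmax' z.1 ⟨hz1.1.le, hz1.2.le⟩ (z.2 - Y z.1) hz2.le
      simp only [Pi.add_apply, add_sub_cancel_left, add_sub_cancel] at this ⊢
      linarith
  have hT0 : t₀ ∈ Set.Ioo 0 T := ⟨by linarith, by linarith⟩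
  have hfin := hsub t₀ hT0 _ hpos _ _ hgrad
  obtain ⟨hYX, hq⟩ := hY t₀ ht0
  have hdist : ‖Y t₀ + y₀ - X t₀‖ ≤ ‖y₀‖ + η := by
    have h3 := norm_add_le (Y t₀ - X t₀) y₀
    have h4 : Y t₀ + y₀ - X t₀ = Y t₀ - X t₀ + y₀ := by abel
    rw [h4]; linarith
  have hnp : ‖(2 * α) • y₀‖ = 2 * α * ‖y₀‖ := by
    rw [norm_smul, Real.norm_eq_abs, abs_of_pos (by positivity)]
  have hq' := hq ((2 * α) • y₀) (-(ψ' t₀ - 2 * α * ⟪y₀, q t₀⟫) -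
      2 * α * ‖y₀‖ * (L * (‖y₀‖ + η))) (by
    intro w hw
    have h1 := hfin w hw
    have h2 := hfl t₀ ⟨hT0.1.le, hT0.2.le⟩ w hw (Y t₀ + y₀) (X t₀)
    have h3 := real_inner_le_norm ((2 * α) • y₀) (f t₀ (Y t₀ + y₀) w - f t₀ (X t₀) w)
    rw [inner_sub_right, hnp] at h3
    have h4 : 2 * α * ‖y₀‖ * ‖f t₀ (Y t₀ + y₀) w - f t₀ (X t₀) w‖ ≤
        2 * α * ‖y₀‖ * (L * (‖y₀‖ + η)) := by
      gcongr
      refine h2.trans ?_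
      gcongr
    linarith)
  rw [hnp, real_inner_smul_left] at hq'
  have h1 := hψl t₀ htb.le
  have h2 : l ≤ 2 * α * ‖y₀‖ * (L * (‖y₀‖ + η)) + 2 * α * ‖y₀‖ * η := by linarith
  have h3 : 2 * α * ‖y₀‖ * (L * (‖y₀‖ + η)) + 2 * α * ‖y₀‖ * η =
      2 * L * (α * ‖y₀‖ ^ 2) + (2 * α * (L + 1) * η) * ‖y₀‖ := by ring
  have h4 : 2 * L * (α * ‖y₀‖ ^ 2) ≤ 2 * L * e := by gcongr
  have h5 : (2 * α * (L + 1) * η) * ‖y₀‖ ≤ 2 * α * (L + 1) * η :=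
    mul_le_of_le_one_right (by positivity) hy0
  linarith

/-- Recursive infeasibility of the over-approximating sets `𝒢̄(t) = {x | v̲(t,x) ≤ 0}`:
for `t₁ ≤ t₂` in `[0,T]`, a state `x̄ ∉ 𝒢̄(t₁)` cannot be driven into `𝒢̄(t₂)` by any
admissible control on `[t₁,t₂]`. -/
theorem over_approx_BRS_recursive_infeasibility {n m : ℕ} (T : ℝ) (hT : 0 < T)
    (U : Set (Fin m → ℝ)) (hUc : IsCompact U) (hUne : U.Nonempty)
    (f : ℝ → EuclideanSpace ℝ (Fin n) → (Fin m → ℝ) → EuclideanSpace ℝ (Fin n))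
    (hfc : ContinuousOn
      (fun z : ℝ × EuclideanSpace ℝ (Fin n) × (Fin m → ℝ) => f z.1 z.2.1 z.2.2)
      (Set.Icc 0 T ×ˢ (Set.univ : Set (EuclideanSpace ℝ (Fin n))) ×ˢ U))
    (L : ℝ) (hL : 0 ≤ L)
    (hfl : ∀ s ∈ Set.Icc (0 : ℝ) T, ∀ w ∈ U, ∀ x y : EuclideanSpace ℝ (Fin n),
      ‖f s x w - f s y w‖ ≤ L * ‖x - y‖)
    (H : ℝ → EuclideanSpace ℝ (Fin n) → EuclideanSpace ℝ (Fin n) → ℝ)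
    (hH : ∀ t ∈ Set.Icc (0 : ℝ) T, ∀ x p,
      IsGreatest ((fun w => ⟪-p, f t x w⟫) '' U) (H t x p))
    (g : EuclideanSpace ℝ (Fin n) → ℝ) (hg : Continuous g)
    (vlow : ℝ → EuclideanSpace ℝ (Fin n) → ℝ)
    (hvc : ContinuousOn (fun z : ℝ × EuclideanSpace ℝ (Fin n) => vlow z.1 z.2)
      (Set.Icc 0 T ×ˢ (Set.univ : Set (EuclideanSpace ℝ (Fin n)))))
    (hsub : ∀ t₀ ∈ Set.Ioo (0 : ℝ) T, ∀ x₀, 0 < vlow t₀ x₀ →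
      ∀ pt px, IsSupGrad vlow t₀ x₀ pt px → -pt + H t₀ x₀ px ≤ 0)
    (glow : EuclideanSpace ℝ (Fin n) → ℝ)
    (hterm : ∀ x, vlow T x = glow x)
    (hglow : ∀ x, g x ≤ 0 → glow x ≤ 0) :
    ∀ t₁ ∈ Set.Icc (0 : ℝ) T, ∀ t₂ ∈ Set.Icc (0 : ℝ) T, t₁ ≤ t₂ →
      ∀ xbar : EuclideanSpace ℝ (Fin n), xbar ∉ {x | vlow t₁ x ≤ 0} →
        ∀ u X, Admissible U t₁ t₂ u → IsTraj f t₁ t₂ xbar u X →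
          X t₂ ∉ {x | vlow t₂ x ≤ 0} := by
  intro t₁ ht₁ t₂ ht₂ h12 xbar hx u X hu hX hcon
  simp only [Set.mem_setOf_eq, not_le] at hx hcon
  have hX1 : X t₁ = xbar := by
    have := hX.2 t₁ ⟨le_rfl, h12⟩
    simpa using this
  have hlt : t₁ < t₂ := by
    refine lt_of_le_of_ne h12 ?_
    rintro rfl
    rw [hX1] at hcon
    linarith
  have hIcc : Set.Icc t₁ t₂ ⊆ Set.Icc 0 T := Set.Icc_subset_Icc ht₁.1 ht₂.2
  have hwc : ContinuousOn (fun t => vlow t (X t)) (Set.Icc t₁ t₂) :=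
    hvc.comp (f := fun t => (t, X t)) (continuousOn_id.prodMk hX.1)
      (fun t ht => ⟨hIcc ht, Set.mem_univ _⟩)
  -- choose c
  obtain ⟨c, hc0, hc⟩ : ∃ c, 0 < vlow c (X c) ∧ c ∈ Set.Ioo t₁ t₂ := by
    have h1 : ContinuousWithinAt (fun t => vlow t (X t)) (Set.Ioo t₁ t₂) t₁ :=
      (hwc t₁ ⟨le_rfl, h12⟩).mono Set.Ioo_subset_Icc_self
    have h2 : ∀ᶠ t in nhdsWithin t₁ (Set.Ioo t₁ t₂), 0 < vlow t (X t) :=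
      h1.eventually_const_lt (by simpa only [hX1] using hx)
    have : (nhdsWithin t₁ (Set.Ioo t₁ t₂)).NeBot := by
      rw [nhdsWithin_Ioo_eq_nhdsGT hlt]; infer_instance
    exact (h2.and self_mem_nhdsWithin).exists
  obtain ⟨b, hb0, hb⟩ : ∃ b, vlow b (X b) < vlow c (X c) / 4 ∧ b ∈ Set.Ioo c t₂ := by
    have h1 : ContinuousWithinAt (fun t => vlow t (X t)) (Set.Ioo c t₂) t₂ :=
      (hwc t₂ ⟨h12, le_rfl⟩).mono (Set.Ioo_subset_Icc_self.trans
        (Set.Icc_subset_Icc_left hc.1.le))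
    have h2 : ∀ᶠ t in nhdsWithin t₂ (Set.Ioo c t₂), vlow t (X t) < vlow c (X c) / 4 :=
      h1.eventually_lt_const (by linarith)
    have : (nhdsWithin t₂ (Set.Ioo c t₂)).NeBot := by
      rw [nhdsWithin_Ioo_eq_nhdsLT hc.2]; infer_instance
    exact (h2.and self_mem_nhdsWithin).exists
  refine core T U f L hL hfl vlow hvc ?_ t₁ c b ht₁.1 hc.1 hb.1 (hb.2.le.trans ht₂.2) X
    (hX.1.mono (Set.Icc_subset_Icc_right hb.2.le)) (vlow c (X c) / 4) (by linarith) (by linarith)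
    hb0.le ?_
  · intro t₀ ht₀ x₀ hv pt px hp w hw
    have h1 := hsub t₀ ht₀ x₀ hv pt px hp
    have h2 := (hH t₀ ⟨ht₀.1.le, ht₀.2.le⟩ x₀ px).2 ⟨w, hw, rfl⟩
    simp only [inner_neg_left] at h2
    linarith
  · intro η hη
    exact exists_approx U hUc f t₁ t₂ b hb.2
      (hfc.mono (Set.prod_mono hIcc (le_refl _))) xbar u X hu hX η hη h12

end
end

section
/- Let T > 0, let H : (0,T) × ℝⁿ × ℝⁿ → ℝ be continuous, let n_q ∈ ℕ, and let v̄₁, …, v̄_{n_q} : [0,T] × ℝⁿ → ℝ be continuously differentiable functions such that for each i and every (t,x) ∈ (0,T) × ℝⁿ with v̄_i(t,x) < 0, −∂_t v̄_i(t,x) + H(t, x, ∇_x v̄_i(t,x)) ≥ 0. Then the pointwise minimum v_m(t,x) = min_{1 ≤ i ≤ n_q} v̄_i(t,x) is a viscosity supersolution of −v_t + H(t,x,∇v) = 0 on the open set {(t,x) ∈ (0,T) × ℝⁿ | v_m(t,x) < 0}; that is, for every (t₀,x₀) in this set and every Fréchet subgradient (p_t, p_x) ∈ D⁻v_m(t₀,x₀),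 −p_t + H(t₀,x₀,p_x) ≥ 0. -/
open scoped RealInnerProductSpace
open Set

noncomputable section

/-- `(pt, px)` is a Fréchet subgradient of `w` at `(t₀, x₀)`:
the liminf as `(t,x) → (t₀,x₀)` of
`[w(t,x) − w(t₀,x₀) − ⟨(pt,px), (t,x) − (t₀,x₀)⟩]/‖(t,x) − (t₀,x₀)‖` is nonnegative. -/
def IsSubGrad {n : ℕ} (w : ℝ → EuclideanSpace ℝ (Fin n) → ℝ) (t₀ : ℝ)
    (x₀ : EuclideanSpace ℝ (Fin n)) (pt : ℝ) (px : EuclideanSpace ℝ (Fin n)) : Prop :=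
  ∀ ε : ℝ, 0 < ε →
    ∀ᶠ z : ℝ × EuclideanSpace ℝ (Fin n) in nhdsWithin (t₀, x₀) {(t₀, x₀)}ᶜ,
      -(ε * ‖(z.1 - t₀, z.2 - x₀)‖) ≤
        w z.1 z.2 - w t₀ x₀ - (pt * (z.1 - t₀) + ⟪px, z.2 - x₀⟫)

/-- The pointwise minimum of a finite collection of `C¹` classical supersolutions of the
PDI `−∂_t v̄_i + H(t, x, ∇_x v̄_i) ≥ 0` on `{v̄_i < 0}` is a viscosity supersolution of
`−v_t + H(t,x,∇v) = 0` on the strict zero-sublevel set of the minimum. -/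
theorem min_is_viscosity_supersolution {n : ℕ} (T : ℝ) (hT : 0 < T)
    (H : ℝ → EuclideanSpace ℝ (Fin n) → EuclideanSpace ℝ (Fin n) → ℝ)
    (hHc : ContinuousOn
      (fun z : ℝ × EuclideanSpace ℝ (Fin n) × EuclideanSpace ℝ (Fin n) => H z.1 z.2.1 z.2.2)
      (Set.Ioo 0 T ×ˢ (Set.univ : Set (EuclideanSpace ℝ (Fin n))) ×ˢ
        (Set.univ : Set (EuclideanSpace ℝ (Fin n)))))
    (nq : ℕ) (hnq : 0 < nq)
    (V : Fin nq → ℝ × EuclideanSpace ℝ (Fin n) → ℝ)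
    (hV : ∀ i, ContDiffOn ℝ 1 (V i)
      (Set.Icc 0 T ×ˢ (Set.univ : Set (EuclideanSpace ℝ (Fin n)))))
    (hPDI : ∀ i, ∀ t ∈ Set.Ioo (0 : ℝ) T, ∀ x, V i (t, x) < 0 →
      0 ≤ -(fderiv ℝ (V i) (t, x) ((1 : ℝ), (0 : EuclideanSpace ℝ (Fin n)))) +
        H t x (gradient (fun y => V i (t, y)) x)) :
    ∀ t₀ ∈ Set.Ioo (0 : ℝ) T, ∀ x₀ : EuclideanSpace ℝ (Fin n),
      (⨅ i, V i (t₀, x₀)) < 0 →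
        ∀ pt px, IsSubGrad (fun t x => ⨅ i, V i (t, x)) t₀ x₀ pt px →
          0 ≤ -pt + H t₀ x₀ px := by
  intro t₀ ht x₀ hneg pt px hsub
  have : Nonempty (Fin nq) := ⟨⟨0, hnq⟩⟩
  obtain ⟨i, hi⟩ := exists_eq_ciInf_of_finite (f := fun i => V i (t₀, x₀))
  have hnhds : (Set.Icc 0 T ×ˢ (Set.univ : Set (EuclideanSpace ℝ (Fin n)))) ∈
      nhds (t₀, x₀) := prod_mem_nhds (Icc_mem_nhds ht.1 ht.2) Filter.univ_mem
  have hd : HasFDerivAt (V i) (fderiv ℝ (V i) (t₀, x₀)) (t₀, x₀) :=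
    (((hV i).contDiffAt hnhds).differentiableAt (by norm_num)).hasFDerivAt
  set L := fderiv ℝ (V i) (t₀, x₀) with hL
  have key : ∀ (a : ℝ) (h : EuclideanSpace ℝ (Fin n)),
      pt * a + ⟪px, h⟫ ≤ L (a, h) := by
    intro a h
    refine le_of_forall_pos_le_add fun δ hδ => ?_
    obtain ⟨ε, hε, hεδ⟩ : ∃ ε : ℝ, 0 < ε ∧ 2 * ε * ‖(a, h)‖ ≤ δ := by
      refine ⟨δ / (2 * (‖(a, h)‖ + 1)), by positivity, ?_⟩
      have : 0 ≤ ‖(a, h)‖ := norm_nonneg _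
      rw [mul_div_assoc', div_mul_eq_mul_div, div_le_iff₀ (by positivity)]
      nlinarith
    have h1 := eventually_nhdsWithin_iff.1 (hsub ε hε)
    have h2 := (hd.isLittleO.def hε)
    have hc : Filter.Tendsto (fun s : ℝ => (t₀ + s * a, x₀ + s • h))
        (nhdsWithin 0 (Set.Ioi 0)) (nhds (t₀, x₀)) := by
      have : Continuous (fun s : ℝ => (t₀ + s * a, x₀ + s • h)) := by fun_prop
      have := this.tendsto 0
      simp only [zero_mul, add_zero, zero_smul] at this
      exact this.mono_left nhdsWithin_le_nhds
    obtain ⟨s, ⟨h1, h2⟩, hs⟩ := ((hc.eventually (h1.and h2)).and self_mem_nhdsWithin).exists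
    have hs : 0 < s := hs
    have hz : ((t₀ + s * a, x₀ + s • h) : ℝ × EuclideanSpace ℝ (Fin n)) - (t₀, x₀)
        = s • (a, h) := by
      ext <;> simp
    rw [hz, map_smul, norm_smul, Real.norm_of_nonneg hs.le, smul_eq_mul, Real.norm_eq_abs] at h2
    have h2 := (abs_le.1 h2).2
    by_cases hah : (a, h) = 0
    · have ha : a = 0 := congrArg Prod.fst hah
      have hh : h = 0 := congrArg Prod.snd hah
      rw [hah, map_zero, ha, hh]
      simp [hδ.le]
    have h1 := h1 (by
      intro hmem
      have hmem : ((t₀ + s * a, x₀ + s • h) : ℝ × EuclideanSpace ℝ (Fin n)) = (t₀, x₀) := hmem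
      rw [hmem, sub_self] at hz
      exact (smul_ne_zero hs.ne' hah) hz.symm)
    have hz' : ‖((s * a, s • h) : ℝ × EuclideanSpace ℝ (Fin n))‖ = s * ‖(a, h)‖ := by
      have e : ((s * a, s • h) : ℝ × EuclideanSpace ℝ (Fin n)) = s • (a, h) := rfl
      rw [e, norm_smul, Real.norm_of_nonneg hs.le]
    have hb : (⨅ j, V j (t₀ + s * a, x₀ + s • h)) ≤ V i (t₀ + s * a, x₀ + s • h) :=
      ciInf_le (Set.finite_range _).bddBelow i
    simp only [add_sub_cancel_left, real_inner_smul_right] at h1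
    rw [← hi, hz'] at h1
    have : s * (pt * a + ⟪px, h⟫) ≤ s * (L (a, h) + 2 * ε * ‖(a, h)‖) := by
      linarith
    have := le_of_mul_le_mul_left this hs
    linarith
  have keq : ∀ (a : ℝ) (h : EuclideanSpace ℝ (Fin n)),
      L (a, h) = pt * a + ⟪px, h⟫ := by
    intro a h
    refine le_antisymm ?_ (key a h)
    have := key (-a) (-h)
    rw [← Prod.neg_mk, map_neg, inner_neg_right] at this
    linarith
  have hg : HasGradientAt (fun y => V i (t₀, y)) px x₀ := by
    rw [hasGradientAt_iff_hasFDerivAt]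
    have := HasFDerivAt.comp x₀ (f := fun y => (t₀, y)) hd (hasFDerivAt_prodMk_right t₀ x₀)
    have e : (InnerProductSpace.toDual ℝ (EuclideanSpace ℝ (Fin n))) px =
        L.comp (ContinuousLinearMap.inr ℝ ℝ (EuclideanSpace ℝ (Fin n))) := by
      refine ContinuousLinearMap.ext fun h => ?_
      rw [InnerProductSpace.toDual_apply_apply, ContinuousLinearMap.comp_apply,
        ContinuousLinearMap.inr_apply, keq]
      simp
    rw [← e] at this
    exact this
  have := hPDI i t₀ ht x₀ (by rw [← hi] at hneg; exact hneg)
  rw [hg.gradient, ← hL, keq] at this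
  simpa using this

end
end

section
/- Let T > 0, let H : (0,T) × ℝⁿ × ℝⁿ → ℝ be continuous, let n_q ∈ ℕ, and let v̲₁, …, v̲_{n_q} : [0,T] × ℝⁿ → ℝ be continuously differentiable functions such that for each i and every (t,x) ∈ (0,T) × ℝⁿ with v̲_i(t,x) > 0, −∂_t v̲_i(t,x) + H(t, x, ∇_x v̲_i(t,x)) ≤ 0. Then the pointwise maximum v_M(t,x) = max_{1 ≤ i ≤ n_q} v̲_i(t,x) is a viscosity subsolution of −v_t + H(t,x,∇v) = 0 on the open set {(t,x) ∈ (0,T) × ℝⁿ | v_M(t,x) > 0}; that is, for every (t₀,x₀) in this set and every Fréchet supergradient (p_t, p_x) ∈ D⁺v_M(t₀,x₀), −p_t + H(t₀,x₀,p_x) ≤ 0. -/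
open scoped RealInnerProductSpace
open Set

noncomputable section

/-- The pointwise maximum of a finite collection of `C¹` classical subsolutions of the
PDI `−∂_t v̲_i + H(t, x, ∇_x v̲_i) ≤ 0` on `{v̲_i > 0}` is a viscosity subsolution of
`−v_t + H(t,x,∇v) = 0` on the strict zero-superlevel set of the maximum. -/
theorem max_is_viscosity_subsolution {n : ℕ} (T : ℝ) (hT : 0 < T)
    (H : ℝ → EuclideanSpace ℝ (Fin n) → EuclideanSpace ℝ (Fin n) → ℝ)
    (hHc : ContinuousOn
      (fun z : ℝ × EuclideanSpace ℝ (Fin n) × EuclideanSpace ℝ (Fin n) => H z.1 z.2.1 z.2.2)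
      (Set.Ioo 0 T ×ˢ (Set.univ : Set (EuclideanSpace ℝ (Fin n))) ×ˢ
        (Set.univ : Set (EuclideanSpace ℝ (Fin n)))))
    (nq : ℕ) (hnq : 0 < nq)
    (V : Fin nq → ℝ × EuclideanSpace ℝ (Fin n) → ℝ)
    (hV : ∀ i, ContDiffOn ℝ 1 (V i)
      (Set.Icc 0 T ×ˢ (Set.univ : Set (EuclideanSpace ℝ (Fin n)))))
    (hPDI : ∀ i, ∀ t ∈ Set.Ioo (0 : ℝ) T, ∀ x, 0 < V i (t, x) →
      -(fderiv ℝ (V i) (t, x) ((1 : ℝ), (0 : EuclideanSpace ℝ (Fin n)))) +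
        H t x (gradient (fun y => V i (t, y)) x) ≤ 0) :
    ∀ t₀ ∈ Set.Ioo (0 : ℝ) T, ∀ x₀ : EuclideanSpace ℝ (Fin n),
      0 < (⨆ i, V i (t₀, x₀)) →
        ∀ pt px, IsSupGrad (fun t x => ⨆ i, V i (t, x)) t₀ x₀ pt px →
          -pt + H t₀ x₀ px ≤ 0 := by
  intro t₀ ht₀ x₀ hpos pt px hsup
  haveI : Nonempty (Fin nq) := ⟨⟨0, hnq⟩⟩
  obtain ⟨i, hi⟩ := exists_eq_ciSup_of_finite (f := fun i => V i (t₀, x₀))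
  have hle : ∀ z, V i z ≤ ⨆ j, V j z := fun z =>
    le_ciSup (f := fun j => V j z) (Set.finite_range _).bddAbove i
  have hnh : Set.Icc 0 T ×ˢ (Set.univ : Set (EuclideanSpace ℝ (Fin n))) ∈ nhds (t₀, x₀) :=
    prod_mem_nhds (Icc_mem_nhds ht₀.1 ht₀.2) Filter.univ_mem
  have hd : DifferentiableAt ℝ (V i) (t₀, x₀) :=
    ((hV i).contDiffAt hnh).differentiableAt (by norm_num)
  have hfd := hd.hasFDerivAt
  set L := fderiv ℝ (V i) (t₀, x₀) with hL
  let P : ℝ × EuclideanSpace ℝ (Fin n) →L[ℝ] ℝ :=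
    pt • ContinuousLinearMap.fst ℝ ℝ (EuclideanSpace ℝ (Fin n)) +
      (innerSL ℝ px).comp (ContinuousLinearMap.snd ℝ ℝ (EuclideanSpace ℝ (Fin n)))
  have hP : ∀ z, P z = pt * z.1 + ⟪px, z.2⟫ := fun z => by simp [P]
  have key : ∀ ε : ℝ, 0 < ε → ∀ v, (L - P) v ≤ ε * ‖v‖ := by
    intro ε hε v
    have h1 : ∀ᶠ z in nhds (t₀, x₀), V i z - V i (t₀, x₀) - P (z - (t₀, x₀))
        ≤ ε / 2 * ‖z - (t₀, x₀)‖ := by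
      have := hsup (ε / 2) (by positivity)
      rw [eventually_nhdsWithin_iff] at this
      filter_upwards [this] with z hz
      by_cases hz0 : z = (t₀, x₀)
      · subst hz0; simp
      · have h2 := hz hz0
        have h3 := hle z
        have h4 := hP (z - (t₀, x₀))
        have h5 : z - (t₀, x₀) = (z.1 - t₀, z.2 - x₀) := rfl
        rw [h5] at h4 ⊢
        simp only at hi h2 h4
        linarith
    have h2 := (hasFDerivAt_iff_isLittleO.mp hfd).def (half_pos hε)
    have ht : Filter.Tendsto (fun s : ℝ => (t₀, x₀) + s • v) (nhdsWithin 0 (Set.Ioi 0))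
        (nhds (t₀, x₀)) := by
      have : Continuous (fun s : ℝ => (t₀, x₀) + s • v) := by fun_prop
      have h := (this.tendsto 0).mono_left (nhdsWithin_le_nhds (s := Set.Ioi 0))
      simpa using h
    obtain ⟨s, ⟨ha, hb⟩, hs⟩ := ((ht.eventually (h1.and h2)).and self_mem_nhdsWithin).exists
    have hs : 0 < s := hs
    rw [add_sub_cancel_left] at ha hb
    rw [Real.norm_eq_abs] at hb
    have hb' := (abs_le.mp hb).1
    rw [norm_smul, Real.norm_eq_abs, abs_of_pos hs] at ha hb'
    rw [map_smul, smul_eq_mul] at ha hb'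
    have : s * ((L - P) v) ≤ s * (ε * ‖v‖) := by
      simp only [ContinuousLinearMap.sub_apply]
      linarith
    exact le_of_mul_le_mul_left this hs
  have hle0 : ∀ v, (L - P) v ≤ 0 := by
    intro v
    by_contra! hc
    have hv : 0 ≤ ‖v‖ := norm_nonneg v
    have h := key ((L - P) v / (2 * (‖v‖ + 1))) (by positivity) v
    rw [div_mul_eq_mul_div, le_div_iff₀ (by positivity)] at h
    nlinarith
  have hLP : ∀ v, L v = P v := by
    intro v
    have h1 := hle0 v
    have h2 := hle0 (-v)
    simp only [ContinuousLinearMap.sub_apply, map_neg] at h1 h2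
    linarith
  have hg : HasGradientAt (fun y => V i (t₀, y)) px x₀ := by
    rw [hasGradientAt_iff_hasFDerivAt]
    have h := hfd.comp x₀ (hasFDerivAt_prodMk_right t₀ x₀)
    refine h.congr_fderiv ?_
    ext y
    simp [hLP, hP]
  have hfin := hPDI i t₀ ht₀ x₀ (by rw [← hi] at hpos; exact hpos)
  rw [hg.gradient, ← hL, hLP, hP] at hfin
  simpa using hfin

end
end

section
/- Let n_q ∈ ℕ, and for each i ∈ {1, …, n_q} let q_i ∈ ℝⁿ and let Q_i be a symmetric positive definite n×n real matrix. Then the function ē : ℝⁿ → ℝ defined by ē(x) = min_{1 ≤ i ≤ n_q} ⟨x − q_i, Q_i⁻¹ (x − q_i)⟩ − 1 is of class Z. -/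
open scoped RealInnerProductSpace

noncomputable section

/-- A function `z` is of class `Z` if for every `x̄` with `z x̄ = 0` and every `r > 0`
there is a point of the open ball `B_r(x̄)` where `z` is negative. -/
def ClassZ {E : Type*} [NormedAddCommGroup E] (z : E → ℝ) : Prop :=
  ∀ x : E, z x = 0 → ∀ r : ℝ, 0 < r → ∃ y ∈ Metric.ball x r, z y < 0

/-- Action of a matrix on a Euclidean vector. -/
def mv {k l : ℕ} (M : Matrix (Fin k) (Fin l) ℝ) (x : EuclideanSpace ℝ (Fin l)) :
    EuclideanSpace ℝ (Fin k) :=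
  (EuclideanSpace.equiv (Fin k) ℝ).symm (M.mulVec ((EuclideanSpace.equiv (Fin l) ℝ) x))

/-- The pointwise minimum of finitely many nondegenerate quadratic forms
`x ↦ ⟨x − qᵢ, Qᵢ⁻¹ (x − qᵢ)⟩ − 1` (with each `Qᵢ` symmetric positive definite)
is of class `Z`. -/
theorem min_quadratics_classZ {n : ℕ} (nq : ℕ) (hnq : 0 < nq)
    (q : Fin nq → EuclideanSpace ℝ (Fin n))
    (Q : Fin nq → Matrix (Fin n) (Fin n) ℝ)
    (hQ : ∀ i, (Q i).PosDef) :
    ClassZ (fun x : EuclideanSpace ℝ (Fin n) =>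
      (⨅ i, ⟪x - q i, mv (Q i)⁻¹ (x - q i)⟫) - 1) := by
  intro x hx r hr
  haveI : Nonempty (Fin nq) := ⟨⟨0, hnq⟩⟩
  obtain ⟨i, hi⟩ := exists_eq_ciInf_of_finite
    (f := fun i => ⟪x - q i, mv (Q i)⁻¹ (x - q i)⟫)
  have h1 : ⟪x - q i, mv (Q i)⁻¹ (x - q i)⟫ = 1 := by
    have hx' : (⨅ i, ⟪x - q i, mv (Q i)⁻¹ (x - q i)⟫) - 1 = 0 := hx
    have hi' : ⟪x - q i, mv (Q i)⁻¹ (x - q i)⟫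
      = ⨅ i, ⟪x - q i, mv (Q i)⁻¹ (x - q i)⟫ := hi
    linarith
  have hN : 0 ≤ ‖x - q i‖ := norm_nonneg _
  obtain ⟨t, ht0, ht1, htr⟩ : ∃ t : ℝ, 0 < t ∧ t < 1 ∧ t * ‖x - q i‖ < r := by
    refine ⟨min (1/2) (r / (‖x - q i‖ + 1)), by positivity, ?_, ?_⟩
    · exact lt_of_le_of_lt (min_le_left _ _) (by norm_num)
    · calc _ ≤ r / (‖x - q i‖ + 1) * ‖x - q i‖ := by
            gcongr
            exact min_le_right _ _
        _ < r := by
            rw [div_mul_eq_mul_div, div_lt_iff₀ (by positivity)]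
            nlinarith
  refine ⟨x - t • (x - q i), ?_, ?_⟩
  · rw [Metric.mem_ball, dist_eq_norm]
    have : x - t • (x - q i) - x = -(t • (x - q i)) := by abel
    rw [this, norm_neg, norm_smul, Real.norm_of_nonneg ht0.le]
    exact htr
  · have hle := ciInf_le (Set.finite_range
      (fun j => ⟪x - t • (x - q i) - q j, mv (Q j)⁻¹ (x - t • (x - q i) - q j)⟫)).bddBelow i
    have he : x - t • (x - q i) - q i = (1 - t) • (x - q i) := by
      rw [sub_smul, one_smul]; abel
    have hm : ∀ v, mv (Q i)⁻¹ ((1 - t) • v) = (1 - t) • mv (Q i)⁻¹ v := by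
      intro v
      simp only [mv, map_smul, Matrix.mulVec_smul]
    simp only [he, hm, inner_smul_left, inner_smul_right, h1] at hle
    simp only [conj_trivial] at hle
    show _ - 1 < (0 : ℝ)
    nlinarith

end
end

section
/- Fix 0 ≤ t ≤ T and consider the linear time-varying system ẋ(s) = A(s)x(s) + B(s)u(s) with A : [0,T] → ℝ^{n×n} and B : [0,T] → ℝ^{n×m} continuous, input constraint u(s) ∈ E(p,P) with P symmetric positive definite, and terminal set 𝒳 = E(x_e, X_e) with X_e symmetric positive definite; let 𝒢(t) = {x ∈ ℝⁿ | ∃ measurable u : [t,T] → E(p,P) with the corresponding solution from x at time t reaching 𝒳 at time T}. For i = 1, …, n_q, let S_i : [0,T] → ℝ^{n×n} be continuous with S_i(t) orthogonal for every t, and let q_i : [0,T] → ℝⁿ and Q_i : [0,T] → ℝ^{n×n}, with Q_i(t) symmetric positive definite for every t, solve the final value problem q̇_i(t) = A(t)q_i(t) + B(t)p, Q̇_i(t) = A(t)Q_i(t) + Q_i(t)A(t)ᵀ − Q_i(t)^{1/2} ( 𝒬_{i,*}(t)^{1/2} S_i(t) + S_i(t)ᵀ 𝒬_{i,*}(t)^{1/2}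 ) Q_i(t)^{1/2} for a.e. t ∈ (0,T), with q_i(T) = x_e and Q_i(T) = X_e, where 𝒬_{i,*}(t) = Q_i(t)^{-1/2} B(t) P B(t)ᵀ Q_i(t)^{-1/2}. Then the union ⋃_{i=1}^{n_q} E(q_i(t), Q_i(t)) is contained in 𝒢(t) for every t ∈ [0,T]. -/
open scoped RealInnerProductSpace
open Matrix Set

noncomputable section

/-- The ellipsoid `E(q, Q) = {x | ⟨x − q, Q⁻¹(x − q)⟩ ≤ 1}`. -/
def ellipsoid {k : ℕ} (q : EuclideanSpace ℝ (Fin k)) (Q : Matrix (Fin k) (Fin k) ℝ) :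
    Set (EuclideanSpace ℝ (Fin k)) :=
  {x | ⟪x - q, mv Q⁻¹ (x - q)⟫ ≤ 1}

/-- The backwards reachable set of the LTV system `ẋ = A(s)x + B(s)u`, `u(s) ∈ E(p,P)`,
with target `E(xe, Xe)` at time `T`, evaluated at time `t`. -/
def ReachLTV {n m : ℕ} (A : ℝ → Matrix (Fin n) (Fin n) ℝ) (B : ℝ → Matrix (Fin n) (Fin m) ℝ)
    (p : EuclideanSpace ℝ (Fin m)) (P : Matrix (Fin m) (Fin m) ℝ)
    (xe : EuclideanSpace ℝ (Fin n)) (Xe : Matrix (Fin n) (Fin n) ℝ)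
    (T t : ℝ) : Set (EuclideanSpace ℝ (Fin n)) :=
  {x | ∃ (u : ℝ → EuclideanSpace ℝ (Fin m)) (X : ℝ → EuclideanSpace ℝ (Fin n)),
    Admissible (ellipsoid p P) t T u ∧ ContinuousOn X (Set.Icc t T) ∧
    (∀ s ∈ Set.Icc t T, X s = x + ∫ r in t..s, (mv (A r) (X r) + mv (B r) (u r))) ∧
    X T ∈ ellipsoid xe Xe}


section sqrtcont
open scoped MatrixOrder Matrix.Norms.L2Operator

lemma sqrt_cont_aux {n : ℕ} {f g : ℝ → Matrix (Fin n) (Fin n) ℝ} {s : Set ℝ}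
    (hf : ContinuousOn f s) (hg : ∀ t ∈ s, (g t).PosSemidef ∧ g t * g t = f t) :
    ContinuousOn g s := by
  have h1 : ∀ t ∈ s, 0 ≤ f t := by
    intro t ht
    obtain ⟨h, h'⟩ := hg t ht
    rw [← h', Matrix.nonneg_iff_posSemidef]
    have := Matrix.posSemidef_conjTranspose_mul_self (g t)
    rwa [h.1] at this
  have h2 : ∀ t ∈ s, g t = CFC.sqrt (f t) := by
    intro t ht
    obtain ⟨h, h'⟩ := hg t ht
    exact (CFC.sqrt_unique h' (Matrix.nonneg_iff_posSemidef.mpr h)).symm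
  refine ContinuousOn.congr ?_ h2
  exact CFC.continuousOn_sqrt.comp hf h1

end sqrtcont

section pinv
open Filter Topology

lemma pinv_aux {n : ℕ} (R : Matrix (Fin n) (Fin n) ℝ) (hR : R.IsHermitian) :
    ∃ K : Matrix (Fin n) (Fin n) ℝ, Kᵀ = K ∧ R * R * K = R ∧
      (∀ z, (K *ᵥ z) ⬝ᵥ ((R * R) *ᵥ (K *ᵥ z)) ≤ z ⬝ᵥ z) ∧
      Tendsto (fun k : ℕ => R * (R * R + ((1 : ℝ) / ((k : ℝ) + 1)) • 1)⁻¹) atTop (𝓝 K) := by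
  set V : Matrix (Fin n) (Fin n) ℝ := (hR.eigenvectorUnitary : Matrix (Fin n) (Fin n) ℝ) with hV
  set d := hR.eigenvalues with hd
  have hVV : Vᵀ * V = 1 := by
    have := Unitary.coe_star_mul_self hR.eigenvectorUnitary
    simpa [Matrix.star_eq_conjTranspose, Matrix.conjTranspose_eq_transpose_of_trivial] using this
  have hVV' : V * Vᵀ = 1 := mul_eq_one_comm.mp hVV
  have hRV : R = V * diagonal d * Vᵀ := by
    have := hR.spectral_theorem
    simpa [Unitary.conjStarAlgAut_apply, Matrix.star_eq_conjTranspose, Matrix.conjTranspose_eq_transpose_of_trivial, Function.comp_def] using this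
  have hmul : ∀ a b : Fin n → ℝ, (V * diagonal a * Vᵀ) * (V * diagonal b * Vᵀ)
      = V * diagonal (fun i => a i * b i) * Vᵀ := by
    intro a b
    calc _ = V * diagonal a * (Vᵀ * V) * diagonal b * Vᵀ := by simp only [Matrix.mul_assoc]
      _ = _ := by rw [hVV, Matrix.mul_one, Matrix.mul_assoc V, diagonal_mul_diagonal]
  have hsym : ∀ a : Fin n → ℝ, (V * diagonal a * Vᵀ)ᵀ = V * diagonal a * Vᵀ := by
    intro a; simp [Matrix.mul_assoc]
  refine ⟨V * diagonal (fun i => (d i)⁻¹) * Vᵀ, hsym _, ?_, ?_, ?_⟩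
  · rw [hRV, hmul, hmul]
    congr 3; ext i
    by_cases h : d i = 0
    · simp [h]
    · field_simp
  · intro z
    have e : ∀ (M : Matrix (Fin n) (Fin n) ℝ) (x y : Fin n → ℝ), (M *ᵥ x) ⬝ᵥ y = x ⬝ᵥ (Mᵀ *ᵥ y) := by
      intro M x y
      rw [dotProduct_comm, dotProduct_mulVec, ← mulVec_transpose, dotProduct_comm]
    rw [e, hsym, Matrix.mulVec_mulVec, Matrix.mulVec_mulVec, hRV, hmul, hmul, hmul]
    set w := Vᵀ *ᵥ z with hw
    have hz : z = V *ᵥ w := by rw [hw, Matrix.mulVec_mulVec, hVV', Matrix.one_mulVec]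
    have h1 : z ⬝ᵥ z = w ⬝ᵥ w := by
      conv_lhs => rw [hz]
      rw [e, Matrix.mulVec_mulVec, hVV, Matrix.one_mulVec]
    rw [← Matrix.mulVec_mulVec, ← Matrix.mulVec_mulVec, ← hw, h1]
    conv_lhs => rw [hz]
    rw [e, Matrix.mulVec_mulVec, hVV, Matrix.one_mulVec]
    simp only [dotProduct, mulVec_diagonal]
    refine Finset.sum_le_sum fun i _ => ?_
    by_cases h : d i = 0
    · simp [h, mul_self_nonneg]
    · apply le_of_eq; field_simp
  · have h1 : ∀ k : ℕ, R * (R * R + ((1 : ℝ) / ((k : ℝ) + 1)) • 1)⁻¹ =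
      V * diagonal (fun i => d i * (d i * d i + (1 : ℝ) / ((k : ℝ) + 1))⁻¹) * Vᵀ := by
      intro k
      have hk : (0 : ℝ) < 1 / ((k : ℝ) + 1) := by positivity
      have h2 : (R * R + ((1 : ℝ) / ((k : ℝ) + 1)) • (1 : Matrix (Fin n) (Fin n) ℝ))⁻¹ =
        V * diagonal (fun i => (d i * d i + (1 : ℝ) / ((k : ℝ) + 1))⁻¹) * Vᵀ := by
        apply Matrix.inv_eq_left_inv
        have h3 : R * R + ((1 : ℝ) / ((k : ℝ) + 1)) • (1 : Matrix (Fin n) (Fin n) ℝ)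
          = V * diagonal (fun i => (d i * d i + (1 : ℝ) / ((k : ℝ) + 1))) * Vᵀ := by
          rw [← diagonal_add, Matrix.mul_add, Matrix.add_mul, hRV, hmul]
          congr 1
          rw [← Matrix.smul_one_eq_diagonal, Matrix.mul_smul, Matrix.smul_mul, Matrix.mul_one, hVV']
        rw [h3, hmul]
        have : (fun i => (d i * d i + (1 : ℝ) / ((k : ℝ) + 1))⁻¹ * (d i * d i + (1 : ℝ) / ((k : ℝ) + 1))) = fun _ => 1 := by
          ext i
          have := mul_self_nonneg (d i)
          exact inv_mul_cancel₀ (by linarith)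
        rw [this, diagonal_one, Matrix.mul_one, hVV']
      rw [h2]; conv_lhs => rw [hRV]
      rw [hmul]
    simp_rw [h1]
    have h4 : Tendsto (fun k : ℕ => (fun i => d i * (d i * d i + (1 : ℝ) / ((k : ℝ) + 1))⁻¹)) atTop
        (𝓝 (fun i => (d i)⁻¹)) := by
      rw [tendsto_pi_nhds]
      intro i
      by_cases h : d i = 0
      · simp [h]
      · have : Tendsto (fun k : ℕ => d i * (d i * d i + (1 : ℝ) / ((k : ℝ) + 1))⁻¹) atTop
          (𝓝 (d i * (d i * d i + 0)⁻¹)) := by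
          refine Tendsto.const_mul _ (Tendsto.inv₀ (tendsto_const_nhds.add tendsto_one_div_add_atTop_nhds_zero_nat) ?_)
          simpa using h
        convert this using 2
        field_simp
        simp
    have hc : Continuous (fun a : Fin n → ℝ => V * diagonal a * Vᵀ) := by fun_prop
    exact (hc.tendsto _).comp h4

end pinv

section ode
open scoped NNReal

lemma ode_aux {n : ℕ} (F : ℝ → Matrix (Fin n) (Fin n) ℝ) {t T : ℝ} (htT : t ≤ T)
    (hF : ContinuousOn F (Icc t T)) (y0 : Fin n → ℝ) :
    ∃ y : ℝ → Fin n → ℝ, y t = y0 ∧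
      ∀ s ∈ Icc t T, HasDerivWithinAt y (F s *ᵥ y s) (Icc t T) s := by
  obtain ⟨K, hK0, hK⟩ : ∃ K : ℝ, 0 ≤ K ∧ ∀ s ∈ Icc t T, ∀ x : Fin n → ℝ, ‖F s *ᵥ x‖ ≤ K * ‖x‖ := by
    let := @Matrix.linftyOpNormedAddCommGroup (Fin n) (Fin n) ℝ _ _ _
    obtain ⟨C, hC⟩ := isCompact_Icc.exists_bound_of_continuousOn hF
    refine ⟨max C 0, le_max_right _ _, fun s hs x => ?_⟩
    refine (Matrix.linfty_opNorm_mulVec (F s) x).trans ?_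
    gcongr
    exact (hC s hs).trans (le_max_left _ _)
  set M : ℝ := gronwallBound ‖y0‖ K 0 (T - t) with hM
  have hMeq : M = ‖y0‖ * Real.exp (K * (T - t)) := by rw [hM, gronwallBound_ε0]
  have hM0 : 0 ≤ M := by rw [hMeq]; positivity
  let π : (Fin n → ℝ) → (Fin n → ℝ) := fun x i => max (-M) (min M (x i))
  have hπL : ∀ x y, ‖π x - π y‖ ≤ ‖x - y‖ := by
    intro x y
    rw [pi_norm_le_iff_of_nonneg (norm_nonneg _)]
    intro i
    refine le_trans ?_ (norm_le_pi_norm (x - y) i)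
    simp only [π, Pi.sub_apply, Real.norm_eq_abs]
    refine (abs_max_sub_max_le_max _ _ _ _).trans ?_
    simp only [sub_self, abs_zero]
    refine max_le (abs_nonneg _) ((abs_min_sub_min_le_max _ _ _ _).trans ?_)
    simp
  have hπ0 : π 0 = 0 := by
    ext i; simp [π, hM0]
  have hπle : ∀ x, ‖π x‖ ≤ ‖x‖ := by
    intro x; simpa [hπ0] using hπL x 0
  have hπM : ∀ x, ‖π x‖ ≤ M := by
    intro x
    rw [pi_norm_le_iff_of_nonneg hM0]
    intro i
    simp only [π, Real.norm_eq_abs, abs_le]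
    exact ⟨le_max_left _ _, max_le (by linarith) (min_le_left _ _)⟩
  have hπid : ∀ x, ‖x‖ ≤ M → π x = x := by
    intro x hx
    ext i
    have := (norm_le_pi_norm x i).trans hx
    rw [Real.norm_eq_abs, abs_le] at this
    simp only [π]
    rw [min_eq_right this.2, max_eq_right this.1]
  have hPL : IsPicardLindelof (fun s x => F s *ᵥ π x) (⟨t, left_mem_Icc.2 htT⟩ : Icc t T) y0
      ((K * M).toNNReal * (T - t).toNNReal) 0 (K * M).toNNReal K.toNNReal := by
    refine ⟨?_, ?_, ?_, ?_⟩
    · intro s hs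
      refine LipschitzWith.lipschitzOnWith ?_
      refine LipschitzWith.of_dist_le_mul fun x y => ?_
      rw [dist_eq_norm, dist_eq_norm, ← Matrix.mulVec_sub, Real.coe_toNNReal _ hK0]
      exact (hK s hs _).trans (mul_le_mul_of_nonneg_left (hπL x y) hK0)
    · intro x _
      exact (Continuous.matrix_mulVec continuous_id continuous_const).comp_continuousOn hF
    · intro s hs x _
      rw [Real.coe_toNNReal _ (by positivity)]
      exact (hK s hs _).trans (mul_le_mul_of_nonneg_left (hπM x) hK0)
    · simp [htT]
  obtain ⟨y, hy0, hy⟩ := hPL.exists_eq_forall_mem_Icc_hasDerivWithinAt₀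
  refine ⟨y, hy0, ?_⟩
  have hyc : ContinuousOn y (Icc t T) := fun s hs => (hy s hs).continuousWithinAt
  have hb := norm_le_gronwallBound_of_norm_deriv_right_le (f := y) (f' := fun s => F s *ᵥ π (y s))
    (δ := ‖y0‖) (K := K) (ε := 0) hyc (fun s hs => ?_) (le_of_eq (by simpa using congrArg norm hy0)) (fun s hs => ?_)
  · intro s hs
    have h1 : ‖y s‖ ≤ M := by
      refine (hb s hs).trans ?_
      rw [gronwallBound_ε0, hMeq]
      have := hs.2
      gcongr
    have := hy s hs
    rwa [hπid _ h1] at this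
  · refine ((hy s ⟨hs.1, hs.2.le⟩).mono_of_mem_nhdsWithin ?_)
    exact Filter.mem_of_superset (Icc_mem_nhdsGE hs.2) (Icc_subset_Icc_left hs.1)
  · rw [add_zero]
    exact (hK s ⟨hs.1, hs.2.le⟩ _).trans (mul_le_mul_of_nonneg_left (hπle _) hK0)
end ode

section inva

lemma inv_cont_aux {n : ℕ} {Q : ℝ → Matrix (Fin n) (Fin n) ℝ} {s : Set ℝ}
    (hQ : ContinuousOn Q s) (h : ∀ r ∈ s, IsUnit (Q r).det) :
    ContinuousOn (fun r => (Q r)⁻¹) s := by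
  have h0 : (fun r => (Q r)⁻¹) = fun r => ((Q r).det)⁻¹ • (Q r).adjugate := by
    ext r : 1
    rw [Matrix.inv_def, Ring.inverse_eq_inv']
  rw [h0]
  refine ContinuousOn.smul (ContinuousOn.inv₀ ?_ fun r hr => (h r hr).ne_zero) ?_
  · exact (Continuous.matrix_det continuous_id).comp_continuousOn hQ
  · exact (Continuous.matrix_adjugate continuous_id).comp_continuousOn hQ

open scoped Matrix.Norms.Operator in
lemma inv_deriv_aux {n : ℕ} {Q : ℝ → Matrix (Fin n) (Fin n) ℝ} {Q' : Matrix (Fin n) (Fin n) ℝ}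
    {r : ℝ} (hQ : ∀ j k, HasDerivAt (fun s => Q s j k) (Q' j k) r) (h : IsUnit (Q r).det) :
    ∀ j k, HasDerivAt (fun s => (Q s)⁻¹ j k) ((-((Q r)⁻¹ * Q' * (Q r)⁻¹)) j k) r := by
  have h1 : HasDerivAt Q Q' r := by
    refine hasDerivAt_pi.2 fun j => hasDerivAt_pi.2 fun k => hQ j k
  have hu : IsUnit (Q r) := (Matrix.isUnit_iff_isUnit_det _).2 h
  obtain ⟨x, hx⟩ := hu
  have h2 := hasFDerivAt_ringInverse (𝕜 := ℝ) x
  rw [hx] at h2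
  have h3 := h2.comp_hasDerivAt r h1
  have h4 : HasDerivAt (fun s => (Q s)⁻¹) (-((Q r)⁻¹ * Q' * (Q r)⁻¹)) r := by
    have e : (Ring.inverse ∘ Q) = fun s => (Q s)⁻¹ := by
      ext s : 1
      exact (Matrix.nonsing_inv_eq_ringInverse (Q s)).symm
    rw [e] at h3
    have hxi : ((x⁻¹ : (Matrix (Fin n) (Fin n) ℝ)ˣ) : Matrix (Fin n) (Fin n) ℝ) = (Q r)⁻¹ := by
      rw [← hx, Matrix.coe_units_inv]
    rw [hxi] at h3
    exact h3
  intro j k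
  exact hasDerivAt_pi.1 (hasDerivAt_pi.1 h4 j) k

lemma alg_aux {n : ℕ} {A Q q R S G W F Q' : Matrix (Fin n) (Fin n) ℝ}
    (hqG : q * G = 1) (hGq : G * q = 1) (hGT : Gᵀ = G) (hqT : qᵀ = q) (hRT : Rᵀ = R)
    (hQ : Q = q * q) (hW : W = G * G)
    (hF : F = A - q * R * S * G)
    (hQ' : Q' = A * Q + Q * Aᵀ - q * (R * S + Sᵀ * R) * q) :
    Fᵀ * W + W * F - W * Q' * W = 0 := by
  have hqG' : ∀ X : Matrix (Fin n) (Fin n) ℝ, q * (G * X) = X := fun X => by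
    rw [← Matrix.mul_assoc, hqG, Matrix.one_mul]
  have hGq' : ∀ X : Matrix (Fin n) (Fin n) ℝ, G * (q * X) = X := fun X => by
    rw [← Matrix.mul_assoc, hGq, Matrix.one_mul]
  subst hQ hW hF hQ'
  simp only [Matrix.transpose_sub, Matrix.transpose_mul, hGT, hqT, hRT, Matrix.mul_add,
    Matrix.add_mul, Matrix.mul_sub, Matrix.sub_mul, Matrix.mul_assoc, hqG', hGq', hqG, Matrix.mul_one]
  abel

lemma inv_const_aux {n : ℕ} {W : ℝ → Matrix (Fin n) (Fin n) ℝ} {y : ℝ → Fin n → ℝ}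
    {F W' : ℝ → Matrix (Fin n) (Fin n) ℝ} {t T : ℝ}
    (hWc : ContinuousOn W (Icc t T)) (hyc : ContinuousOn y (Icc t T))
    (hW : ∀ r ∈ Ioo t T, ∀ j k, HasDerivAt (fun s => W s j k) (W' r j k) r)
    (hy : ∀ r ∈ Ioo t T, HasDerivAt y (F r *ᵥ y r) r)
    (h0 : ∀ r ∈ Ioo t T, (F r)ᵀ * W r + W r * F r + W' r = 0) :
    ∀ s ∈ Icc t T, y s ⬝ᵥ (W s *ᵥ y s) = y t ⬝ᵥ (W t *ᵥ y t) := by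
  intro s hs
  rcases eq_or_lt_of_le hs.1 with h | h
  · rw [← h]
  have hsub : Icc t s ⊆ Icc t T := Icc_subset_Icc_right hs.2
  have hVc : ContinuousOn (fun r => y r ⬝ᵥ (W r *ᵥ y r)) (Icc t s) := by
    have : Continuous (fun z : (Fin n → ℝ) × Matrix (Fin n) (Fin n) ℝ => z.1 ⬝ᵥ (z.2 *ᵥ z.1)) := by
      fun_prop
    exact this.comp_continuousOn ((hyc.mono hsub).prodMk (hWc.mono hsub))
  have hV : ∀ r ∈ Ioo t s, HasDerivAt (fun r => y r ⬝ᵥ (W r *ᵥ y r)) ((fun _ => (0 : ℝ)) r) r := by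
    intro r hr
    have hr' : r ∈ Ioo t T := ⟨hr.1, hr.2.trans_le hs.2⟩
    have hyi := hasDerivAt_pi.1 (hy r hr')
    have hWy : ∀ i, HasDerivAt (fun r => (W r *ᵥ y r) i)
        ((W' r *ᵥ y r) i + (W r *ᵥ (F r *ᵥ y r)) i) r := by
      intro i
      simp only [mulVec, dotProduct]
      rw [← Finset.sum_add_distrib]
      exact HasDerivAt.fun_sum fun j _ => (hW r hr' i j).mul (hyi j)
    have hd : HasDerivAt (fun r => y r ⬝ᵥ (W r *ᵥ y r))
        (∑ i, ((F r *ᵥ y r) i * (W r *ᵥ y r) i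
          + y r i * ((W' r *ᵥ y r) i + (W r *ᵥ (F r *ᵥ y r)) i))) r :=
      HasDerivAt.fun_sum fun i _ => (hyi i).mul (hWy i)
    convert hd using 1
    rw [Finset.sum_add_distrib]
    change 0 = (F r *ᵥ y r) ⬝ᵥ (W r *ᵥ y r) + y r ⬝ᵥ (W' r *ᵥ y r + W r *ᵥ (F r *ᵥ y r))
    have e : (F r *ᵥ y r) ⬝ᵥ (W r *ᵥ y r) = y r ⬝ᵥ ((F r)ᵀ *ᵥ (W r *ᵥ y r)) := by
      rw [dotProduct_comm, dotProduct_mulVec, ← mulVec_transpose, dotProduct_comm]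
    rw [e, ← dotProduct_add, Matrix.mulVec_mulVec, Matrix.mulVec_mulVec, ← Matrix.add_mulVec,
      ← Matrix.add_mulVec, add_comm (W' r), ← add_assoc, h0 r hr']
    simp
  obtain ⟨c, _, hc⟩ := exists_hasDerivAt_eq_slope _ _ h hVc hV
  have : s - t ≠ 0 := by linarith
  field_simp at hc
  linarith

lemma mem_ellipsoid_aux {k : ℕ} (x q : EuclideanSpace ℝ (Fin k)) (Q : Matrix (Fin k) (Fin k) ℝ)
    (y : Fin k → ℝ) (hy : x - q = (EuclideanSpace.equiv (Fin k) ℝ).symm y) :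
    x ∈ ellipsoid q Q ↔ y ⬝ᵥ (Q⁻¹ *ᵥ y) ≤ 1 := by
  unfold ellipsoid mv
  rw [Set.mem_ofPred_eq, hy, EuclideanSpace.inner_eq_star_dotProduct]
  rw [ContinuousLinearEquiv.apply_symm_apply, dotProduct_comm]
  rfl

/-- The feedback control. -/
lemma control_alg_aux {n m : ℕ} {B : Matrix (Fin n) (Fin m) ℝ} {P : Matrix (Fin m) (Fin m) ℝ}
    (hP : P.PosDef)
    {q R S G K W : Matrix (Fin n) (Fin n) ℝ} 
    (hqG : q * G = 1) (hGq : G * q = 1) (hGT : Gᵀ = G)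
    (hW : W = G * G) (hS : Sᵀ * S = 1)
    (hR : R * R = G * (B * P * Bᵀ) * G)
    (hRK : R * R * K = R)
    (hKz : ∀ z, (K *ᵥ z) ⬝ᵥ ((R * R) *ᵥ (K *ᵥ z)) ≤ z ⬝ᵥ z) (y : Fin n → ℝ) :
    B *ᵥ (-((P * Bᵀ * G * K * S * G) *ᵥ y)) = - ((q * R * S * G) *ᵥ y) ∧
    (-((P * Bᵀ * G * K * S * G) *ᵥ y)) ⬝ᵥ (P⁻¹ *ᵥ (-((P * Bᵀ * G * K * S * G) *ᵥ y))) ≤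
      y ⬝ᵥ (W *ᵥ y) := by
  have e : ∀ {a b : ℕ} (M : Matrix (Fin a) (Fin b) ℝ) (x : Fin b → ℝ) (y : Fin a → ℝ),
      (M *ᵥ x) ⬝ᵥ y = x ⬝ᵥ (Mᵀ *ᵥ y) := by
    intro a b M x y
    rw [dotProduct_comm, dotProduct_mulVec, ← mulVec_transpose, dotProduct_comm]
  have hPT : Pᵀ = P := by
    have := hP.1
    rwa [Matrix.IsHermitian, Matrix.conjTranspose_eq_transpose_of_trivial] at this
  have hPd : IsUnit P.det := (Matrix.isUnit_iff_isUnit_det _).1 hP.isUnit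
  have hGq' : ∀ X : Matrix (Fin n) (Fin n) ℝ, G * (q * X) = X := fun X => by
    rw [← Matrix.mul_assoc, hGq, Matrix.one_mul]
  have hqG' : ∀ X : Matrix (Fin n) (Fin n) ℝ, q * (G * X) = X := fun X => by
    rw [← Matrix.mul_assoc, hqG, Matrix.one_mul]
  constructor
  · rw [Matrix.mulVec_neg, Matrix.mulVec_mulVec]
    congr 2
    have : q * R * S * G = q * (R * R * K) * S * G := by rw [hRK]
    rw [this, hR]
    simp only [Matrix.mul_assoc, hqG']
  · set z := (S * G) *ᵥ y with hz
    have h1 : (P * Bᵀ * G * K * S * G) *ᵥ y = P *ᵥ ((Bᵀ * G) *ᵥ (K *ᵥ z)) := by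
      rw [hz]; simp only [Matrix.mulVec_mulVec, Matrix.mul_assoc]
    rw [h1, Matrix.mulVec_neg, dotProduct_neg, neg_dotProduct, neg_neg, Matrix.mulVec_mulVec _ P⁻¹,
      Matrix.nonsing_inv_mul _ hPd, Matrix.one_mulVec, dotProduct_comm, e (Bᵀ * G)]
    have h2 : (Bᵀ * G)ᵀ *ᵥ (P *ᵥ ((Bᵀ * G) *ᵥ (K *ᵥ z))) = (R * R) *ᵥ (K *ᵥ z) := by
      rw [hR]
      simp only [Matrix.mulVec_mulVec, Matrix.mul_assoc, Matrix.transpose_mul, hGT, Matrix.transpose_transpose]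
    rw [h2]
    refine (hKz z).trans (le_of_eq ?_)
    conv_lhs => rw [hz, e]
    rw [Matrix.mulVec_mulVec, Matrix.transpose_mul, hGT, hW]
    congr 2
    rw [Matrix.mul_assoc, ← Matrix.mul_assoc Sᵀ, hS, Matrix.one_mul]
end inva

section core
open Filter Topology MeasureTheory

lemma mv_cont_aux {k l : ℕ} {M : ℝ → Matrix (Fin k) (Fin l) ℝ} {x : ℝ → EuclideanSpace ℝ (Fin l)}
    {s : Set ℝ} (hM : ContinuousOn M s) (hx : ContinuousOn x s) :
    ContinuousOn (fun r => mv (M r) (x r)) s := by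
  have : Continuous (fun z : Matrix (Fin k) (Fin l) ℝ × EuclideanSpace ℝ (Fin l) => mv z.1 z.2) := by
    unfold mv
    refine (EuclideanSpace.equiv (Fin k) ℝ).symm.continuous.comp ?_
    exact Continuous.matrix_mulVec continuous_fst
      ((EuclideanSpace.equiv (Fin l) ℝ).continuous.comp continuous_snd)
  exact this.comp_continuousOn (hM.prodMk hx)

lemma mv_add_aux {k l : ℕ} (M : Matrix (Fin k) (Fin l) ℝ) (x y : EuclideanSpace ℝ (Fin l)) :
    mv M (x + y) = mv M x + mv M y := by
  unfold mv
  rw [map_add, Matrix.mulVec_add, map_add]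

lemma mv_symm_aux {k l : ℕ} (M : Matrix (Fin k) (Fin l) ℝ) (y : Fin l → ℝ) :
    mv M ((EuclideanSpace.equiv (Fin l) ℝ).symm y) = (EuclideanSpace.equiv (Fin k) ℝ).symm (M *ᵥ y) := by
  unfold mv
  rw [ContinuousLinearEquiv.apply_symm_apply]

lemma mulc {s : Set ℝ} {a b c : ℕ} {f : ℝ → Matrix (Fin a) (Fin b) ℝ}
    {g : ℝ → Matrix (Fin b) (Fin c) ℝ} (hf : ContinuousOn f s) (hg : ContinuousOn g s) :
    ContinuousOn (fun r => f r * g r) s := by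
  have hc : Continuous (fun z : Matrix (Fin a) (Fin b) ℝ × Matrix (Fin b) (Fin c) ℝ =>
      z.1 * z.2) := Continuous.matrix_mul continuous_fst continuous_snd
  exact hc.comp_continuousOn (hf.prodMk hg)

lemma core_aux {n m : ℕ} (t T : ℝ) (hT : t ≤ T)
    (A : ℝ → Matrix (Fin n) (Fin n) ℝ) (hA : ContinuousOn A (Set.Icc t T))
    (B : ℝ → Matrix (Fin n) (Fin m) ℝ) (hB : ContinuousOn B (Set.Icc t T))
    (p : EuclideanSpace ℝ (Fin m)) (P : Matrix (Fin m) (Fin m) ℝ) (hP : P.PosDef)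
    (xe : EuclideanSpace ℝ (Fin n)) (Xe : Matrix (Fin n) (Fin n) ℝ)
    (q : ℝ → EuclideanSpace ℝ (Fin n))
    (Q : ℝ → Matrix (Fin n) (Fin n) ℝ)
    (Qs : ℝ → Matrix (Fin n) (Fin n) ℝ)
    (R : ℝ → Matrix (Fin n) (Fin n) ℝ)
    (S : ℝ → Matrix (Fin n) (Fin n) ℝ)
    (hS_cont : ContinuousOn S (Set.Icc t T))
    (hS_orth : ∀ r ∈ Set.Icc t T, (S r)ᵀ * S r = 1)
    (hQpos : ∀ r ∈ Set.Icc t T, (Q r).PosDef)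
    (hQs : ∀ r ∈ Set.Icc t T,
      (Qs r).PosSemidef ∧ Qs r * Qs r = Q r)
    (hRs : ∀ r ∈ Set.Icc t T,
      (R r).PosSemidef ∧
        R r * R r = (Qs r)⁻¹ * (B r * P * (B r)ᵀ) * (Qs r)⁻¹)
    (hq_cont : ContinuousOn q (Set.Icc t T))
    (hQ_cont : ContinuousOn Q (Set.Icc t T))
    (hq_ode : ∀ r ∈ Set.Ioo t T,
      HasDerivAt q (mv (A r) (q r) + mv (B r) p) r)
    (hQ_ode : ∀ r ∈ Set.Ioo t T, ∀ j k : Fin n,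
      HasDerivAt (fun s => Q s j k)
        ((A r * Q r + Q r * (A r)ᵀ -
          Qs r * (R r * S r + (S r)ᵀ * R r) * Qs r) j k) r)
    (hqT : q T = xe) (hQT : Q T = Xe) :
    ellipsoid (q t) (Q t) ⊆ ReachLTV A B p P xe Xe T t := by
  classical
  intro x hx
  set I := Icc t T with hI
  have hQsc : ContinuousOn Qs I := sqrt_cont_aux hQ_cont hQs
  have hQd : ∀ r ∈ I, IsUnit (Q r).det := fun r hr =>
    (Matrix.isUnit_iff_isUnit_det _).1 (hQpos r hr).isUnit
  have hQsd : ∀ r ∈ I, IsUnit (Qs r).det := by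
    intro r hr
    have := hQd r hr
    rw [← (hQs r hr).2, Matrix.det_mul] at this
    exact isUnit_of_mul_isUnit_left this
  set G := fun r => (Qs r)⁻¹ with hG
  have hGc : ContinuousOn G I := inv_cont_aux hQsc hQsd
  have hqG : ∀ r ∈ I, Qs r * G r = 1 := fun r hr => Matrix.mul_nonsing_inv _ (hQsd r hr)
  have hGq : ∀ r ∈ I, G r * Qs r = 1 := fun r hr => Matrix.nonsing_inv_mul _ (hQsd r hr)
  have tr : ∀ {M : Matrix (Fin n) (Fin n) ℝ}, M.PosSemidef → Mᵀ = M := by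
    intro M hM
    have := hM.1
    rwa [Matrix.IsHermitian, Matrix.conjTranspose_eq_transpose_of_trivial] at this
  have hqT' : ∀ r ∈ I, (Qs r)ᵀ = Qs r := fun r hr => tr (hQs r hr).1
  have hGT : ∀ r ∈ I, (G r)ᵀ = G r := fun r hr => by
    simp only [hG]; rw [Matrix.transpose_nonsing_inv, hqT' r hr]
  have hRT : ∀ r ∈ I, (R r)ᵀ = R r := fun r hr => tr (hRs r hr).1
  have hW : ∀ r ∈ I, (Q r)⁻¹ = G r * G r := fun r hr => by
    rw [← (hQs r hr).2, Matrix.mul_inv_rev]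
  have hRc : ContinuousOn R I :=
    sqrt_cont_aux (mulc (mulc hGc (mulc (mulc hB continuousOn_const) (Continuous.matrix_transpose continuous_id |>.comp_continuousOn hB))) hGc) hRs
  set F := fun r => A r - Qs r * R r * S r * G r with hF
  have hFc : ContinuousOn F I := hA.sub (((hQsc.mul hRc).mul hS_cont).mul hGc)
  obtain ⟨y, hy0, hy⟩ := ode_aux F hT hFc (EuclideanSpace.equiv (Fin n) ℝ (x - q t))
  have hyc : ContinuousOn y I := fun s hs => (hy s hs).continuousWithinAt
  have hyd : ∀ r ∈ Ioo t T, HasDerivAt y (F r *ᵥ y r) r := fun r hr =>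
    (hy r (Ioo_subset_Icc_self hr)).hasDerivAt (Icc_mem_nhds hr.1 hr.2)
  have hconst := inv_const_aux (W := fun r => (Q r)⁻¹) (inv_cont_aux hQ_cont hQd) hyc
    (fun r hr => inv_deriv_aux (hQ_ode r hr) (hQd r (Ioo_subset_Icc_self hr))) hyd (fun r hr => by
      have hr' := Ioo_subset_Icc_self hr
      have := alg_aux (hqG r hr') (hGq r hr') (hGT r hr') (hqT' r hr') (hRT r hr')
        (hQs r hr').2.symm (hW r hr') (F := F r) (A := A r) rfl rfl
      rwa [sub_eq_add_neg] at this)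
  have hV0 : y t ⬝ᵥ ((Q t)⁻¹ *ᵥ y t) ≤ 1 := by
    refine (mem_ellipsoid_aux x (q t) (Q t) (y t) ?_).1 hx
    rw [hy0, ContinuousLinearEquiv.symm_apply_apply]
  have hV : ∀ s ∈ I, y s ⬝ᵥ ((Q s)⁻¹ *ᵥ y s) ≤ 1 := fun s hs => (hconst s hs).le.trans hV0
  -- pseudo-inverse
  have hK : ∀ r, ∃ K : Matrix (Fin n) (Fin n) ℝ, r ∈ I → (Kᵀ = K ∧ R r * R r * K = R r ∧
      (∀ z, (K *ᵥ z) ⬝ᵥ ((R r * R r) *ᵥ (K *ᵥ z)) ≤ z ⬝ᵥ z) ∧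
      Tendsto (fun k : ℕ => R r * (R r * R r + ((1 : ℝ) / ((k : ℝ) + 1)) • 1)⁻¹) atTop (𝓝 K)) := by
    intro r
    by_cases hr : r ∈ I
    · obtain ⟨K, h⟩ := pinv_aux (R r) (hRs r hr).1.1
      exact ⟨K, fun _ => h⟩
    · exact ⟨0, fun h => absurd h hr⟩
  choose K hK using hK
  let v : ℝ → Matrix (Fin n) (Fin n) ℝ → Fin m → ℝ :=
    fun r L => -((P * (B r)ᵀ * G r * L * S r * G r) *ᵥ y r)
  let e := EuclideanSpace.equiv (Fin m) ℝ
  let en := EuclideanSpace.equiv (Fin n) ℝ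
  let u : ℝ → EuclideanSpace ℝ (Fin m) := I.piecewise (fun r => p + e.symm (v r (K r))) (fun _ => p)
  have hu : ∀ r ∈ I, u r = p + e.symm (v r (K r)) := fun r hr => Set.piecewise_eq_of_mem _ _ _ hr
  have hctl : ∀ r (hr : r ∈ I), _ := fun r hr => control_alg_aux hP (hqG r hr) (hGq r hr) (hGT r hr)
      (hW r hr) (hS_orth r hr) (hRs r hr).2 (hK r hr).2.1 (hK r hr).2.2.1 (y r)
  have humeas : Measurable u := by
    let w : ℕ → ℝ → EuclideanSpace ℝ (Fin m) := fun k => I.piecewise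
      (fun r => p + e.symm (v r (R r * (R r * R r + ((1 : ℝ) / ((k : ℝ) + 1)) • 1)⁻¹))) (fun _ => p)
    refine measurable_of_tendsto_metrizable (f := w) (fun k => ?_) ?_
    · refine ContinuousOn.measurable_piecewise ?_ continuousOn_const measurableSet_Icc
      have h1 : ContinuousOn (fun r => (R r * R r + ((1 : ℝ) / ((k : ℝ) + 1)) • (1 : Matrix (Fin n) (Fin n) ℝ))⁻¹) I := by
        refine inv_cont_aux ((hRc.mul hRc).add continuousOn_const) fun r hr => ?_
        refine (Matrix.isUnit_iff_isUnit_det _).1 (Matrix.PosDef.isUnit ?_)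
        refine Matrix.PosDef.posSemidef_add ?_ (Matrix.PosDef.one.smul (by positivity))
        have := Matrix.posSemidef_conjTranspose_mul_self (R r)
        rwa [(hRs r hr).1.1] at this
      have h2 : ContinuousOn (fun r => v r (R r * (R r * R r + ((1 : ℝ) / ((k : ℝ) + 1)) • 1)⁻¹)) I := by
        refine ContinuousOn.neg ?_
        have hc : Continuous (fun z : Matrix (Fin m) (Fin n) ℝ × (Fin n → ℝ) => z.1 *ᵥ z.2) :=
          Continuous.matrix_mulVec continuous_fst continuous_snd
        refine hc.comp_continuousOn (ContinuousOn.prodMk ?_ hyc)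
        exact mulc (mulc (mulc (mulc (mulc continuousOn_const (Continuous.matrix_transpose continuous_id |>.comp_continuousOn hB)) hGc) (mulc hRc h1)) hS_cont) hGc
      exact continuousOn_const.add (e.symm.continuous.comp_continuousOn h2)
    · rw [tendsto_pi_nhds]
      intro r
      by_cases hr : r ∈ I
      · rw [hu r hr]
        have hw : ∀ k, w k r = p + e.symm (v r (R r * (R r * R r + ((1 : ℝ) / ((k : ℝ) + 1)) • 1)⁻¹)) :=
          fun k => Set.piecewise_eq_of_mem _ _ _ hr
        simp_rw [hw]
        have hc : Continuous (fun L => p + e.symm (v r L)) := by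
          refine continuous_const.add (e.symm.continuous.comp ?_)
          simp only [v]
          fun_prop
        exact (hc.tendsto _).comp (hK r hr).2.2.2
      · have hw : ∀ k, w k r = p := fun k => Set.piecewise_eq_of_notMem _ _ _ hr
        have hu' : u r = p := Set.piecewise_eq_of_notMem _ _ _ hr
        simp_rw [hw, hu']
        exact tendsto_const_nhds
  let X : ℝ → EuclideanSpace ℝ (Fin n) := fun s => q s + en.symm (y s)
  have hXc : ContinuousOn X I := hq_cont.add (en.symm.continuous.comp_continuousOn hyc)
  have hval : ∀ r ∈ I, mv (A r) (X r) + mv (B r) (u r) =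
      (mv (A r) (q r) + mv (B r) p) + en.symm (F r *ᵥ y r) := by
    intro r hr
    rw [hu r hr]
    simp only [X, mv_add_aux]
    have h1 : mv (B r) (e.symm (v r (K r))) = en.symm (B r *ᵥ v r (K r)) := mv_symm_aux _ _
    have h2 : mv (A r) (en.symm (y r)) = en.symm (A r *ᵥ y r) := mv_symm_aux _ _
    have h3 : en.symm (F r *ᵥ y r) = en.symm (A r *ᵥ y r) + en.symm (B r *ᵥ v r (K r)) := by
      rw [← map_add]
      congr 1
      simp only [v]
      rw [(hctl r hr).1]
      simp only [hF]
      rw [Matrix.sub_mulVec, sub_eq_add_neg]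
    rw [h1, h2, h3]
    abel
  have hX0 : X t = x := by
    simp only [X, hy0, en]
    rw [ContinuousLinearEquiv.symm_apply_apply]
    abel
  refine ⟨u, X, ⟨humeas, ?_⟩, hXc, ?_, ?_⟩
  · intro s hs
    refine (mem_ellipsoid_aux (u s) p P (v s (K s)) ?_).2 ((hctl s hs).2.trans (hV s hs))
    rw [hu s hs, add_sub_cancel_left]
  · intro s hs
    have hsub : Icc t s ⊆ I := Icc_subset_Icc_right hs.2
    have hcongr : ∫ r in t..s, (mv (A r) (X r) + mv (B r) (u r)) =
        ∫ r in t..s, ((mv (A r) (q r) + mv (B r) p) + en.symm (F r *ᵥ y r)) := by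
      refine intervalIntegral.integral_congr fun r hr => ?_
      rw [uIcc_of_le hs.1] at hr
      exact hval r (hsub hr)
    rw [hcongr, intervalIntegral.integral_eq_sub_of_hasDerivAt_of_le hs.1 (hXc.mono hsub), hX0]
    · abel
    · intro r hr
      have hr' : r ∈ Ioo t T := ⟨hr.1, hr.2.trans_le hs.2⟩
      exact (hq_ode r hr').add (en.symm.toContinuousLinearMap.hasFDerivAt.comp_hasDerivAt r (hyd r hr'))
    · refine ContinuousOn.intervalIntegrable ?_
      rw [uIcc_of_le hs.1]
      refine ContinuousOn.mono ?_ hsub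
      refine ((mv_cont_aux hA hq_cont).add (mv_cont_aux hB continuousOn_const)).add ?_
      have hc : Continuous (fun z : Matrix (Fin n) (Fin n) ℝ × (Fin n → ℝ) => z.1 *ᵥ z.2) :=
          Continuous.matrix_mulVec continuous_fst continuous_snd
      exact en.symm.continuous.comp_continuousOn (hc.comp_continuousOn (hFc.prodMk hyc))
  · have hTI : T ∈ I := right_mem_Icc.2 hT
    rw [← hqT, ← hQT]
    refine (mem_ellipsoid_aux _ _ _ (y T) ?_).2 (hV T hTI)
    simp only [X, add_sub_cancel_left, en]

end core

/-- The union of the ellipsoids `E(qᵢ(t), Qᵢ(t))` generated by the under-approximating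
final value problem under-approximates the backwards reachable set of the LTV system. -/
theorem ellipsoidal_under_approx_BRS {n m : ℕ} (T : ℝ) (hT : 0 ≤ T)
    (A : ℝ → Matrix (Fin n) (Fin n) ℝ) (hA : ContinuousOn A (Set.Icc 0 T))
    (B : ℝ → Matrix (Fin n) (Fin m) ℝ) (hB : ContinuousOn B (Set.Icc 0 T))
    (p : EuclideanSpace ℝ (Fin m)) (P : Matrix (Fin m) (Fin m) ℝ) (hP : P.PosDef)
    (xe : EuclideanSpace ℝ (Fin n)) (Xe : Matrix (Fin n) (Fin n) ℝ) (hXe : Xe.PosDef)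
    (nq : ℕ)
    (qm : Fin nq → ℝ → EuclideanSpace ℝ (Fin n))
    (Qm : Fin nq → ℝ → Matrix (Fin n) (Fin n) ℝ)
    -- `Qs i t` is the p.s.d. square root `Qᵢ(t)^{1/2}`
    (Qs : Fin nq → ℝ → Matrix (Fin n) (Fin n) ℝ)
    -- `Rs i t` is the p.s.d. square root `𝒬_{i,*}(t)^{1/2}` of
    -- `𝒬_{i,*}(t) = Qᵢ(t)^{-1/2} B(t) P B(t)ᵀ Qᵢ(t)^{-1/2}`
    (Rs : Fin nq → ℝ → Matrix (Fin n) (Fin n) ℝ)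
    (Sm : Fin nq → ℝ → Matrix (Fin n) (Fin n) ℝ)
    (hS_cont : ∀ i, ContinuousOn (Sm i) (Set.Icc 0 T))
    (hS_orth : ∀ i, ∀ t ∈ Set.Icc (0 : ℝ) T, (Sm i t)ᵀ * Sm i t = 1)
    (hQpos : ∀ i, ∀ t ∈ Set.Icc (0 : ℝ) T, (Qm i t).PosDef)
    (hQs : ∀ i, ∀ t ∈ Set.Icc (0 : ℝ) T,
      (Qs i t).PosSemidef ∧ Qs i t * Qs i t = Qm i t)
    (hRs : ∀ i, ∀ t ∈ Set.Icc (0 : ℝ) T,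
      (Rs i t).PosSemidef ∧
        Rs i t * Rs i t = (Qs i t)⁻¹ * (B t * P * (B t)ᵀ) * (Qs i t)⁻¹)
    (hq_cont : ∀ i, ContinuousOn (qm i) (Set.Icc 0 T))
    (hQ_cont : ∀ i, ContinuousOn (Qm i) (Set.Icc 0 T))
    (hq_ode : ∀ i, ∀ t ∈ Set.Ioo (0 : ℝ) T,
      HasDerivAt (qm i) (mv (A t) (qm i t) + mv (B t) p) t)
    (hQ_ode : ∀ i, ∀ t ∈ Set.Ioo (0 : ℝ) T, ∀ j k : Fin n,
      HasDerivAt (fun s => Qm i s j k)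
        ((A t * Qm i t + Qm i t * (A t)ᵀ -
          Qs i t * (Rs i t * Sm i t + (Sm i t)ᵀ * Rs i t) * Qs i t) j k) t)
    (hqT : ∀ i, qm i T = xe) (hQT : ∀ i, Qm i T = Xe) :
    ∀ t ∈ Set.Icc (0 : ℝ) T,
      (⋃ i : Fin nq, ellipsoid (qm i t) (Qm i t)) ⊆ ReachLTV A B p P xe Xe T t := by
  intro t ht
  refine iUnion_subset fun i => ?_
  have h1 : Icc t T ⊆ Icc 0 T := Icc_subset_Icc_left ht.1
  have h2 : Ioo t T ⊆ Ioo 0 T := Ioo_subset_Ioo_left ht.1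
  exact core_aux t T ht.2 A (hA.mono h1) B (hB.mono h1) p P hP xe Xe (qm i) (Qm i) (Qs i) (Rs i)
    (Sm i) ((hS_cont i).mono h1) (fun r hr => hS_orth i r (h1 hr)) (fun r hr => hQpos i r (h1 hr))
    (fun r hr => hQs i r (h1 hr)) (fun r hr => hRs i r (h1 hr)) ((hq_cont i).mono h1)
    ((hQ_cont i).mono h1) (fun r hr => hq_ode i r (h2 hr)) (fun r hr => hQ_ode i r (h2 hr))
    (hqT i) (hQT i)

end
end

section
/- Consider the linear time-varying system ẋ(s) = A(s)x(s) + B(s)u(s) with A : [0,T] → ℝ^{n×n} and B : [0,T] → ℝ^{n×m} continuous, input set E(p,P) with P symmetric positive definite, and terminal set 𝒳 = E(x_e, X_e) with X_e symmetric positive definite. Fix t ∈ [0,T] and an index i, let S_i : [0,T] → ℝ^{n×n} be continuous and orthogonal-valued, and let q_i, Q_i (with Q_i(s) symmetric positive definite for all s) solve the final value problem q̇_i = A q_i + B p, Q̇_i = A Q_i + Q_i Aᵀ − Q_i^{1/2}(𝒬_{i,*}^{1/2} S_i + S_iᵀ 𝒬_{i,*}^{1/2})Q_i^{1/2}, q_i(T)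 = x_e, Q_i(T) = X_e, where 𝒬_{i,*}(s) = Q_i(s)^{-1/2} B(s) P B(s)ᵀ Q_i(s)^{-1/2}. Let x* : [t,T] → ℝⁿ be an absolutely continuous solution of the system with some measurable control u* : [t,T] → E(p,P) and x*(T) ∈ 𝒳, set ŵ_i(s) = Q_i(s)^{-1/2}(x*(s) − q_i(s)), and suppose S_i(s) ŵ_i(s)/‖ŵ_i(s)‖₂ = 𝒬_{i,*}(s)^{1/2} ŵ_i(s)/‖𝒬_{i,*}(s)^{1/2} ŵ_i(s)‖₂ for all s ∈ [t,T] with 𝒬_{i,*}(s)^{1/2} ŵ_i(s) ≠ 0. Then x*(s) ∈ E(q_i(s), Q_i(s)) for all s ∈ [t,T]. -/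
open scoped RealInnerProductSpace
open Matrix Set

noncomputable section

lemma fenchel {n : ℕ} {Q : Matrix (Fin n) (Fin n) ℝ} (hQ : Q.PosDef) (y w : Fin n → ℝ) :
    2 * (y ⬝ᵥ w) - y ⬝ᵥ Q *ᵥ y ≤ w ⬝ᵥ Q⁻¹ *ᵥ w := by
  have hu : IsUnit Q.det := hQ.det_pos.ne'.isUnit
  have hT : Qᵀ = Q := by simpa using hQ.isHermitian.eq
  have h := hQ.posSemidef.dotProduct_mulVec_nonneg (Q⁻¹ *ᵥ w - y)
  have h1 : Q *ᵥ (Q⁻¹ *ᵥ w) = w := by simp [Matrix.mulVec_mulVec, Matrix.mul_nonsing_inv _ hu]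
  have h2 : (Q⁻¹ *ᵥ w) ⬝ᵥ Q *ᵥ y = y ⬝ᵥ w := by
    rw [Matrix.dotProduct_mulVec, ← Matrix.mulVec_transpose, hT, h1, dotProduct_comm]
  simp only [star_trivial, Matrix.mulVec_sub, h1, sub_dotProduct, dotProduct_sub, h2] at h
  rw [dotProduct_comm (Q⁻¹ *ᵥ w) w] at h
  linarith

lemma support {n : ℕ} {P : Matrix (Fin n) (Fin n) ℝ} (hP : P.PosDef) (b v : Fin n → ℝ)
    (hv : v ⬝ᵥ P⁻¹ *ᵥ v ≤ 1) : |b ⬝ᵥ v| ≤ Real.sqrt (b ⬝ᵥ P *ᵥ b) := by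
  apply Real.abs_le_sqrt
  have h := fun c : ℝ => fenchel hP (c • b) v
  simp only [Matrix.mulVec_smul, smul_dotProduct, dotProduct_smul, smul_eq_mul] at h
  have := discrim_le_zero (a := b ⬝ᵥ P *ᵥ b) (b := -2 * (b ⬝ᵥ v)) (c := 1)
    (fun c => by have := h c; nlinarith)
  unfold discrim at this
  nlinarith

lemma inner_eq {k : ℕ} (x y : EuclideanSpace ℝ (Fin k)) :
    ⟪y, x⟫ = y.ofLp ⬝ᵥ x.ofLp := by
  simp [PiLp.inner_apply, dotProduct, mul_comm]

lemma mv_ofLp {k l : ℕ} (M : Matrix (Fin k) (Fin l) ℝ) (x : EuclideanSpace ℝ (Fin l)) :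
    (mv M x).ofLp = M *ᵥ x.ofLp := rfl

lemma inner_mv {k l : ℕ} (M : Matrix (Fin k) (Fin l) ℝ) (x : EuclideanSpace ℝ (Fin l)) (y : EuclideanSpace ℝ (Fin k)) :
    ⟪y, mv M x⟫ = y.ofLp ⬝ᵥ M *ᵥ x.ofLp := by
  rw [inner_eq, mv_ofLp]

lemma mv_cont {k l : ℕ} : Continuous (fun z : Matrix (Fin k) (Fin l) ℝ × EuclideanSpace ℝ (Fin l) => mv z.1 z.2) := by
  unfold mv
  fun_prop

/-- the pointwise algebra: derivative of the lower bound -/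
lemma algebra {n m : ℕ} (A : Matrix (Fin n) (Fin n) ℝ) (B : Matrix (Fin n) (Fin m) ℝ)
    (P : Matrix (Fin m) (Fin m) ℝ) (Q Qs R S : Matrix (Fin n) (Fin n) ℝ)
    (hQ : Q.PosDef) (hQs : Qs.PosSemidef) (hQQ : Qs * Qs = Q) (hR : R.PosSemidef)
    (hRR : R * R = Qs⁻¹ * (B * P * Bᵀ) * Qs⁻¹) (w : EuclideanSpace ℝ (Fin n))
    (hS : mv R (mv Qs⁻¹ w) ≠ 0 → ‖mv Qs⁻¹ w‖⁻¹ • mv S (mv Qs⁻¹ w) =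
          ‖mv R (mv Qs⁻¹ w)‖⁻¹ • mv R (mv Qs⁻¹ w))
    (h1 : 1 < w.ofLp ⬝ᵥ Q⁻¹ *ᵥ w.ofLp)
    (y : Fin n → ℝ) (hy : y = Q⁻¹ *ᵥ w.ofLp) :
    0 ≤ 2 * (y ⬝ᵥ A *ᵥ w.ofLp) - 2 * Real.sqrt ((Bᵀ *ᵥ y) ⬝ᵥ P *ᵥ (Bᵀ *ᵥ y))
      - y ⬝ᵥ (A * Q + Q * Aᵀ - Qs * (R * S + Sᵀ * R) * Qs) *ᵥ y := by
  have hu : IsUnit Q.det := hQ.det_pos.ne'.isUnit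
  have hus : IsUnit Qs.det := by
    rw [← hQQ, Matrix.det_mul] at hu
    exact isUnit_of_mul_isUnit_left hu
  have hQT : Qᵀ = Q := by simpa using hQ.isHermitian.eq
  have hQsT : Qsᵀ = Qs := by simpa using hQs.isHermitian.eq
  have hQsiT : Qs⁻¹ᵀ = Qs⁻¹ := by rw [Matrix.transpose_nonsing_inv, hQsT]
  have hRT : Rᵀ = R := by simpa using hR.isHermitian.eq
  set z := mv Qs⁻¹ w with hz
  have hyz : y = Qs⁻¹ *ᵥ z.ofLp := by
    rw [hy, hz, mv_ofLp, Matrix.mulVec_mulVec, ← Matrix.mul_inv_rev, hQQ]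
  clear_value z
  have hQsy : Qs *ᵥ y = z.ofLp := by
    rw [hyz, Matrix.mulVec_mulVec, Matrix.mul_nonsing_inv _ hus, Matrix.one_mulVec]
  have hQy : Q *ᵥ y = w.ofLp := by
    rw [hy, Matrix.mulVec_mulVec, Matrix.mul_nonsing_inv _ hu, Matrix.one_mulVec]
  have sym : ∀ (M : Matrix (Fin n) (Fin n) ℝ) (a b : Fin n → ℝ), a ⬝ᵥ M *ᵥ b = (Mᵀ *ᵥ a) ⬝ᵥ b := by
    intro M a b
    rw [Matrix.dotProduct_mulVec, Matrix.mulVec_transpose]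
  have e1 : y ⬝ᵥ (A * Q) *ᵥ y = y ⬝ᵥ A *ᵥ w.ofLp := by
    rw [← Matrix.mulVec_mulVec, hQy]
  have e2 : y ⬝ᵥ (Q * Aᵀ) *ᵥ y = y ⬝ᵥ A *ᵥ w.ofLp := by
    rw [← Matrix.mulVec_mulVec, sym, hQT, hQy, sym, transpose_transpose, dotProduct_comm]
  have e3 : y ⬝ᵥ (Qs * (R * S + Sᵀ * R) * Qs) *ᵥ y = 2 * ⟪mv R z, mv S z⟫ := by
    rw [← Matrix.mulVec_mulVec, hQsy, ← Matrix.mulVec_mulVec, sym, hQsT, hQsy, Matrix.add_mulVec,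
      dotProduct_add, ← Matrix.mulVec_mulVec, ← Matrix.mulVec_mulVec, sym R, hRT, sym Sᵀ, transpose_transpose,
      inner_eq, mv_ofLp, mv_ofLp, dotProduct_comm (S *ᵥ z.ofLp)]
    ring
  have e4 : (Bᵀ *ᵥ y) ⬝ᵥ P *ᵥ (Bᵀ *ᵥ y) = ‖mv R z‖ ^ 2 := by
    rw [← real_inner_self_eq_norm_sq, inner_eq, mv_ofLp]
    have : (R *ᵥ z.ofLp) ⬝ᵥ (R *ᵥ z.ofLp) = z.ofLp ⬝ᵥ (R * R) *ᵥ z.ofLp := by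
      rw [← Matrix.mulVec_mulVec, sym R z.ofLp, hRT]
    rw [this, hRR, ← Matrix.mulVec_mulVec, ← hyz, ← Matrix.mulVec_mulVec, sym, hQsiT, ← hyz,
      ← Matrix.mulVec_mulVec, ← Matrix.mulVec_mulVec, Matrix.dotProduct_mulVec y B, Matrix.mulVec_transpose]
  have e5 : w.ofLp ⬝ᵥ Q⁻¹ *ᵥ w.ofLp = ‖z‖ ^ 2 := by
    rw [← real_inner_self_eq_norm_sq, inner_eq, hz, mv_ofLp, ← hQQ, Matrix.mul_inv_rev, ← Matrix.mulVec_mulVec,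
      sym, hQsiT]
  have hz1 : 1 < ‖z‖ := by
    rw [e5] at h1
    nlinarith [norm_nonneg z]
  have e6 : ⟪mv R z, mv S z⟫ = ‖z‖ * ‖mv R z‖ := by
    by_cases h0 : mv R z = 0
    · simp [h0]
    · have h := hS h0
      have hn : ‖mv R z‖ ≠ 0 := by simpa using h0
      have hS' : mv S z = (‖z‖ * ‖mv R z‖⁻¹) • mv R z := by
        rw [mul_smul, ← h, smul_smul, mul_inv_cancel₀ (by linarith), one_smul]
      rw [hS', inner_smul_right, real_inner_self_eq_norm_sq]
      field_simp
  rw [e4, Real.sqrt_sq (norm_nonneg _), Matrix.sub_mulVec, Matrix.add_mulVec, dotProduct_sub,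
    dotProduct_add, e1, e2, e3, e6]
  nlinarith [norm_nonneg (mv R z)]

set_option maxHeartbeats 1000000 in
lemma integ {n m : ℕ} (t T : ℝ)
    (A : ℝ → Matrix (Fin n) (Fin n) ℝ) (hA : ContinuousOn A (Set.Icc t T))
    (B : ℝ → Matrix (Fin n) (Fin m) ℝ) (hB : ContinuousOn B (Set.Icc t T))
    (p : EuclideanSpace ℝ (Fin m)) (P : Matrix (Fin m) (Fin m) ℝ) (hP : P.PosDef)
    (x : ℝ → EuclideanSpace ℝ (Fin n)) (hx : ContinuousOn x (Icc t T))
    (u : ℝ → EuclideanSpace ℝ (Fin m)) (hum : Measurable u)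
    (huE : ∀ s ∈ Icc t T, u s ∈ ellipsoid p P) :
    MeasureTheory.IntegrableOn (fun r => mv (A r) (x r) + mv (B r) (u r)) (Icc t T) := by
  apply MeasureTheory.Integrable.add
  · exact (mv_cont.comp_continuousOn (hA.prodMk hx)).integrableOn_Icc
  · obtain ⟨R, hR⟩ : ∃ R, ∀ v ∈ ellipsoid p P, v ∈ Metric.closedBall p R := by
      refine ⟨Real.sqrt (∑ i, P i i), fun v hv => ?_⟩
      have hv' : (v - p).ofLp ⬝ᵥ P⁻¹ *ᵥ (v - p).ofLp ≤ 1 := by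
        rw [← inner_mv]; exact hv
      rw [Metric.mem_closedBall, EuclideanSpace.dist_eq]
      apply Real.sqrt_le_sqrt
      apply Finset.sum_le_sum
      intro i _
      have h := support hP (Pi.single i 1) _ hv'
      have hp : 0 ≤ P i i := hP.posSemidef.diag_nonneg
      simp only [single_one_dotProduct, Matrix.mulVec_single_one, Matrix.col_apply] at h
      have h2 := (Real.le_sqrt (abs_nonneg _) hp).1 h
      rw [Real.dist_eq]
      simpa using h2
    have hcont : ContinuousOn (fun z : ℝ × EuclideanSpace ℝ (Fin m) => mv (B z.1) z.2)
        (Icc t T ×ˢ Metric.closedBall p R) := by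
      refine mv_cont.comp_continuousOn (f := fun z : ℝ × EuclideanSpace ℝ (Fin m) => (B z.1, z.2)) ?_
      exact (hB.comp continuousOn_fst (fun z hz => hz.1)).prodMk continuousOn_snd
    obtain ⟨C, hC⟩ := (isCompact_Icc.prod (isCompact_closedBall p R)).exists_bound_of_continuousOn hcont
    have : TopologicalSpace.PseudoMetrizableSpace (Matrix (Fin n) (Fin m) ℝ) :=
      inferInstanceAs (TopologicalSpace.PseudoMetrizableSpace (Fin n → Fin m → ℝ))
    refine MeasureTheory.Integrable.of_bound (C := C) ?_ ?_
    · have h1 := hB.aestronglyMeasurable (μ := MeasureTheory.volume) measurableSet_Icc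
      have h2 : MeasureTheory.AEStronglyMeasurable u (MeasureTheory.volume.restrict (Icc t T)) :=
        hum.aestronglyMeasurable
      have h3 := mv_cont.comp_aestronglyMeasurable (h1.prodMk h2)
      exact h3
    · rw [MeasureTheory.ae_restrict_iff' measurableSet_Icc]
      exact Filter.Eventually.of_forall fun r hr => hC (r, u r) ⟨hr, hR _ (huE r hr)⟩

set_option maxHeartbeats 600000 in
/-- Any solution of the LTV system reaching the terminal ellipsoid `E(xe, Xe)` stays inside
the under-approximating ellipsoid `E(qᵢ(s), Qᵢ(s))` on `[t,T]`, provided the orthogonal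
matrix `Sᵢ` rotates `ŵᵢ/‖ŵᵢ‖` to `𝒬ᵢ⋆^{1/2}ŵᵢ/‖𝒬ᵢ⋆^{1/2}ŵᵢ‖` along the solution. -/
theorem solution_contained_in_under_approx_ellipsoid {n m : ℕ} (t T : ℝ)
    (ht : 0 ≤ t) (htT : t ≤ T)
    (A : ℝ → Matrix (Fin n) (Fin n) ℝ) (hA : ContinuousOn A (Set.Icc 0 T))
    (B : ℝ → Matrix (Fin n) (Fin m) ℝ) (hB : ContinuousOn B (Set.Icc 0 T))
    (p : EuclideanSpace ℝ (Fin m)) (P : Matrix (Fin m) (Fin m) ℝ) (hP : P.PosDef)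
    (xe : EuclideanSpace ℝ (Fin n)) (Xe : Matrix (Fin n) (Fin n) ℝ) (hXe : Xe.PosDef)
    (qm : ℝ → EuclideanSpace ℝ (Fin n))
    (Qm : ℝ → Matrix (Fin n) (Fin n) ℝ)
    -- `Qs s` is the p.s.d. square root `Qᵢ(s)^{1/2}`
    (Qs : ℝ → Matrix (Fin n) (Fin n) ℝ)
    -- `Rs s` is the p.s.d. square root `𝒬_{i,*}(s)^{1/2}` of
    -- `𝒬_{i,*}(s) = Qᵢ(s)^{-1/2} B(s) P B(s)ᵀ Qᵢ(s)^{-1/2}`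
    (Rs : ℝ → Matrix (Fin n) (Fin n) ℝ)
    (Sm : ℝ → Matrix (Fin n) (Fin n) ℝ)
    (hS_cont : ContinuousOn Sm (Set.Icc 0 T))
    (hS_orth : ∀ s ∈ Set.Icc (0 : ℝ) T, (Sm s)ᵀ * Sm s = 1)
    (hQpos : ∀ s ∈ Set.Icc (0 : ℝ) T, (Qm s).PosDef)
    (hQs : ∀ s ∈ Set.Icc (0 : ℝ) T, (Qs s).PosSemidef ∧ Qs s * Qs s = Qm s)
    (hRs : ∀ s ∈ Set.Icc (0 : ℝ) T,
      (Rs s).PosSemidef ∧ Rs s * Rs s = (Qs s)⁻¹ * (B s * P * (B s)ᵀ) * (Qs s)⁻¹)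
    (hq_cont : ContinuousOn qm (Set.Icc 0 T))
    (hQ_cont : ContinuousOn Qm (Set.Icc 0 T))
    (hq_ode : ∀ s ∈ Set.Ioo (0 : ℝ) T,
      HasDerivAt qm (mv (A s) (qm s) + mv (B s) p) s)
    (hQ_ode : ∀ s ∈ Set.Ioo (0 : ℝ) T, ∀ j k : Fin n,
      HasDerivAt (fun r => Qm r j k)
        ((A s * Qm s + Qm s * (A s)ᵀ -
          Qs s * (Rs s * Sm s + (Sm s)ᵀ * Rs s) * Qs s) j k) s)
    (hqT : qm T = xe) (hQT : Qm T = Xe)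
    (xstar : ℝ → EuclideanSpace ℝ (Fin n)) (ustar : ℝ → EuclideanSpace ℝ (Fin m))
    (hu : Admissible (ellipsoid p P) t T ustar)
    (hx_cont : ContinuousOn xstar (Set.Icc t T))
    (hx : ∀ s ∈ Set.Icc t T,
      xstar s = xstar t + ∫ r in t..s, (mv (A r) (xstar r) + mv (B r) (ustar r)))
    (hxT : xstar T ∈ ellipsoid xe Xe)
    (hSw : ∀ s ∈ Set.Icc t T,
      mv (Rs s) (mv (Qs s)⁻¹ (xstar s - qm s)) ≠ 0 →
        ‖mv (Qs s)⁻¹ (xstar s - qm s)‖⁻¹ • mv (Sm s) (mv (Qs s)⁻¹ (xstar s - qm s)) =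
          ‖mv (Rs s) (mv (Qs s)⁻¹ (xstar s - qm s))‖⁻¹ •
            mv (Rs s) (mv (Qs s)⁻¹ (xstar s - qm s))) :
    ∀ s ∈ Set.Icc t T, xstar s ∈ ellipsoid (qm s) (Qm s) := by
  classical
  have hV : ∀ s, xstar s ∈ ellipsoid (qm s) (Qm s) ↔
      (xstar s - qm s).ofLp ⬝ᵥ (Qm s)⁻¹ *ᵥ (xstar s - qm s).ofLp ≤ 1 := by
    intro s
    rw [← inner_mv]; rfl
  set V : ℝ → ℝ := fun s => (xstar s - qm s).ofLp ⬝ᵥ (Qm s)⁻¹ *ᵥ (xstar s - qm s).ofLp with hVdef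
  have hsub : Icc t T ⊆ Icc 0 T := Icc_subset_Icc_left ht
  have hVc : ContinuousOn V (Icc t T) := by
    have h1 : ContinuousOn (fun s => (Qm s)⁻¹) (Icc t T) := by
      intro s hs
      have hd : (Qm s).det ≠ 0 := (hQpos s (hsub hs)).det_pos.ne'
      have : ContinuousAt (fun M : Matrix (Fin n) (Fin n) ℝ => M⁻¹) (Qm s) := by
        apply continuousAt_matrix_inv
        rw [Ring.inverse_eq_inv']
        exact continuousAt_inv₀ hd
      exact this.comp_continuousWithinAt ((hQ_cont.mono hsub) s hs)
    have h2 : ContinuousOn (fun s => (xstar s - qm s)) (Icc t T) :=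
      hx_cont.sub (hq_cont.mono hsub)
    have h3 : Continuous (fun z : Matrix (Fin n) (Fin n) ℝ × EuclideanSpace ℝ (Fin n) =>
      z.2.ofLp ⬝ᵥ z.1 *ᵥ z.2.ofLp) := by fun_prop
    exact h3.comp_continuousOn (h1.prodMk h2)
  have hVT : V T ≤ 1 := by
    rw [← hV, hqT, hQT]; exact hxT
  -- integrability
  obtain ⟨hum, huE⟩ := hu
  have hint : MeasureTheory.IntegrableOn
      (fun r => mv (A r) (xstar r) + mv (B r) (ustar r)) (Icc t T) := by
    exact integ t T A (hA.mono hsub) B (hB.mono hsub) p P hP xstar hx_cont ustar hum huE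
  have key : ∀ s ∈ Ioo t T, ∃ G : ℝ → ℝ, ∃ D : ℝ, HasDerivAt G D s ∧ G s = V s ∧
      (∀ r ∈ Icc s T, G r ≤ V r) ∧ (1 < V s → 0 ≤ D) := by
    intro s hs
    have hs0 : s ∈ Ioo 0 T := ⟨ht.trans_lt hs.1, hs.2⟩
    have hsI : s ∈ Icc t T := Ioo_subset_Icc_self hs
    have hsI0 : s ∈ Icc 0 T := hsub hsI
    obtain ⟨y, hy⟩ : ∃ y, y = (Qm s)⁻¹ *ᵥ (xstar s - qm s).ofLp := ⟨_, rfl⟩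
    set φ : ℝ → ℝ := fun r => y ⬝ᵥ (A r) *ᵥ (xstar r).ofLp + y ⬝ᵥ (B r) *ᵥ p.ofLp
      - Real.sqrt (((B r)ᵀ *ᵥ y) ⬝ᵥ P *ᵥ ((B r)ᵀ *ᵥ y)) with hφ
    have hφc : ContinuousOn φ (Icc t T) := by
      have h3 : Continuous (fun z : Matrix (Fin n) (Fin n) ℝ × Matrix (Fin n) (Fin m) ℝ × EuclideanSpace ℝ (Fin n) =>
        y ⬝ᵥ z.1 *ᵥ z.2.2.ofLp + y ⬝ᵥ z.2.1 *ᵥ p.ofLp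
          - Real.sqrt ((z.2.1ᵀ *ᵥ y) ⬝ᵥ P *ᵥ (z.2.1ᵀ *ᵥ y))) := by fun_prop
      have h4 := (hA.mono hsub).prodMk ((hB.mono hsub).prodMk hx_cont)
      have h5 := h3.comp_continuousOn h4
      simp only [Function.comp_def] at h5
      exact h5
    have hIφ : HasDerivAt (fun r => ∫ x in s..r, φ x) (φ s) s := by
      apply intervalIntegral.integral_hasDerivAt_right
      · simp
      · exact (hφc.mono Ioo_subset_Icc_self).stronglyMeasurableAtFilter isOpen_Ioo s hs
      · exact hφc.continuousAt (Icc_mem_nhds hs.1 hs.2)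
    have hqd : HasDerivAt (fun r => y ⬝ᵥ (qm r).ofLp)
        (y ⬝ᵥ (A s *ᵥ (qm s).ofLp) + y ⬝ᵥ (B s *ᵥ p.ofLp)) s := by
      have := (hasDerivAt_const s (WithLp.toLp 2 y)).inner ℝ (hq_ode s hs0)
      simpa [inner_eq, mv_ofLp, dotProduct_add] using this
    have hQd : HasDerivAt (fun r => y ⬝ᵥ Qm r *ᵥ y)
        (y ⬝ᵥ (A s * Qm s + Qm s * (A s)ᵀ -
          Qs s * (Rs s * Sm s + (Sm s)ᵀ * Rs s) * Qs s) *ᵥ y) s := by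
      have : ∀ M : Matrix (Fin n) (Fin n) ℝ, y ⬝ᵥ M *ᵥ y = ∑ j, ∑ k, y j * (M j k * y k) := by
        intro M
        simp [dotProduct, Matrix.mulVec, Finset.mul_sum]
      simp only [this]
      refine HasDerivAt.fun_sum fun j _ => HasDerivAt.fun_sum fun k _ => ?_
      exact ((hQ_ode s hs0 j k).mul_const (y k)).const_mul (y j)
    refine ⟨fun r => 2 * (y ⬝ᵥ (xstar s).ofLp + ∫ x in s..r, φ x) - 2 * (y ⬝ᵥ (qm r).ofLp)
      - y ⬝ᵥ Qm r *ᵥ y, _, (((hIφ.const_add _).const_mul 2).sub (hqd.const_mul 2)).sub hQd, ?_, ?_, ?_⟩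
    · have hu' : IsUnit (Qm s).det := (hQpos s hsI0).det_pos.ne'.isUnit
      have : Qm s *ᵥ y = (xstar s - qm s).ofLp := by
        rw [hy, Matrix.mulVec_mulVec, Matrix.mul_nonsing_inv _ hu', Matrix.one_mulVec]
      simp only [intervalIntegral.integral_same, this, hVdef, ← hy]
      rw [dotProduct_comm _ y]
      simp only [WithLp.ofLp_sub, dotProduct_sub]
      ring
    · intro r hr
      have hrI : r ∈ Icc t T := ⟨hs.1.le.trans hr.1, hr.2⟩
      have hF := fenchel (hQpos r (hsub hrI)) y (xstar r - qm r).ofLp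
      refine le_trans ?_ hF
      have ii : ∀ a ∈ Icc t T, ∀ b ∈ Icc t T, IntervalIntegrable
          (fun r => mv (A r) (xstar r) + mv (B r) (ustar r)) MeasureTheory.volume a b := by
        intro a ha b hb
        apply MeasureTheory.IntegrableOn.intervalIntegrable
        exact hint.mono_set (uIcc_subset_Icc ha hb)
      have htI : t ∈ Icc t T := left_mem_Icc.2 htT
      have hxr : xstar r = xstar s + ∫ r in s..r, (mv (A r) (xstar r) + mv (B r) (ustar r)) := by
        rw [hx r hrI, hx s hsI, add_assoc,
          intervalIntegral.integral_add_adjacent_intervals (ii _ htI _ hsI) (ii _ hsI _ hrI)]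
      have hyx : y ⬝ᵥ (xstar r).ofLp = y ⬝ᵥ (xstar s).ofLp +
          ∫ r in s..r, y ⬝ᵥ (mv (A r) (xstar r) + mv (B r) (ustar r)).ofLp := by
        have h := (innerSL ℝ (WithLp.toLp 2 y)).intervalIntegral_comp_comm (ii _ hsI _ hrI)
        simp only [innerSL_apply_apply, inner_eq] at h
        rw [h]
        conv_lhs => rw [hxr]
        rw [WithLp.ofLp_add, dotProduct_add]
      have hmono : ∫ x in s..r, φ x ≤
          ∫ r in s..r, y ⬝ᵥ (mv (A r) (xstar r) + mv (B r) (ustar r)).ofLp := by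
        apply intervalIntegral.integral_mono_on hr.1
        · apply ContinuousOn.intervalIntegrable
          exact hφc.mono (uIcc_subset_Icc hsI hrI)
        · have h := ii _ hsI _ hrI
          rw [intervalIntegrable_iff] at h ⊢
          have h' := (innerSL ℝ (WithLp.toLp 2 y)).integrable_comp h
          simp only [innerSL_apply_apply, inner_eq] at h'
          exact h'
        · intro v hv
          have hvI : v ∈ Icc t T := ⟨hs.1.le.trans hv.1, hv.2.trans hr.2⟩
          have hE := huE v hvI
          have hE' : (ustar v - p).ofLp ⬝ᵥ P⁻¹ *ᵥ (ustar v - p).ofLp ≤ 1 := by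
            rw [← inner_mv]; exact hE
          have hsup := support hP ((B v)ᵀ *ᵥ y) _ hE'
          have hlow := (abs_le.1 hsup).1
          have hb : ∀ c : Fin m → ℝ, y ⬝ᵥ B v *ᵥ c = ((B v)ᵀ *ᵥ y) ⬝ᵥ c := fun c => by
            rw [Matrix.mulVec_transpose, Matrix.dotProduct_mulVec]
          rw [WithLp.ofLp_sub, dotProduct_sub, ← hb p.ofLp, ← hb (ustar v).ofLp] at hlow
          simp only [hφ, WithLp.ofLp_add, mv_ofLp, dotProduct_add]
          linarith
      simp only [WithLp.ofLp_sub, dotProduct_sub]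
      rw [hyx]
      linarith
    · intro h1
      have h := algebra (A s) (B s) P (Qm s) (Qs s) (Rs s) (Sm s) (hQpos s hsI0) (hQs s hsI0).1
        (hQs s hsI0).2 (hRs s hsI0).1 (hRs s hsI0).2 (xstar s - qm s) (hSw s hsI) h1 y hy
      refine h.trans (le_of_eq ?_)
      simp only [hφ, WithLp.ofLp_sub, Matrix.mulVec_sub, dotProduct_sub]
      ring
  -- conclusion
  intro s0 hs0
  rw [hV]
  change V s0 ≤ 1
  by_contra! hcon
  have hs0T : s0 < T := by
    rcases hs0.2.lt_or_eq with h | h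
    · exact h
    · rw [h] at hcon; linarith
  obtain ⟨s1, hs1, hVs1⟩ : ∃ s1 ∈ Ioo s0 T, 1 < V s1 := by
    have h1 : ContinuousWithinAt V (Ioo s0 T) s0 := 
      (hVc s0 hs0).mono (fun r hr => ⟨hs0.1.trans hr.1.le, hr.2.le⟩)
    have h2 := h1.eventually (lt_mem_nhds hcon)
    have : (nhdsWithin s0 (Ioo s0 T)).NeBot := by
      rw [← mem_closure_iff_nhdsWithin_neBot, closure_Ioo hs0T.ne]
      exact left_mem_Icc.2 hs0T.le
    obtain ⟨r, hr1, hr2⟩ := (h2.and self_mem_nhdsWithin).exists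
    exact ⟨r, hr2, hr1⟩
  have hsub1 : ∀ r ∈ Ico s1 T, r ∈ Ioo t T := fun r hr => ⟨(hs0.1.trans_lt hs1.1).trans_le hr.1, hr.2⟩
  choose! G D hG hGs hGV hD using key
  obtain ⟨ε, hε, hεT⟩ : ∃ ε : ℝ, 0 < ε ∧ ε * (T - s1) < V s1 - 1 := by
    have hT1 : 0 < T - s1 := sub_pos.2 hs1.2
    refine ⟨(V s1 - 1) / (2 * (T - s1)), by apply div_pos <;> linarith, ?_⟩
    field_simp
    linarith
  have := image_le_of_liminf_slope_right_lt_deriv_boundary' (f := fun r => - V r)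
    (f' := fun r => - D r) (a := s1) (b := T) (B := fun r => - V s1 + ε * (r - s1))
    (B' := fun _ => ε) ?_ ?_ ?_ ?_ ?_ ?_ (right_mem_Icc.2 hs1.2.le)
  · linarith
  · exact (hVc.mono (Icc_subset_Icc_left (hs0.1.trans hs1.1.le))).neg
  · intro x hx' r hr
    have hxm := hsub1 x hx'
    apply Filter.Eventually.frequently
    have h1 := (hG x hxm).neg.hasDerivWithinAt (s := Ioi x)
    rw [hasDerivWithinAt_iff_tendsto_slope' (by simp)] at h1
    have h2 := h1.eventually (gt_mem_nhds hr)
    filter_upwards [h2, Ioo_mem_nhdsGT hx'.2] with z hz hzI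
    refine lt_of_le_of_lt ?_ hz
    have hzx : 0 < z - x := sub_pos.2 hzI.1
    rw [slope_def_field, slope_def_field]
    have := hGV x hxm z ⟨hzI.1.le, hzI.2.le⟩
    have := hGs x hxm
    simp only [Pi.neg_apply]
    apply div_le_div_of_nonneg_right _ hzx.le
    linarith
  · simp
  · fun_prop
  · intro x _
    have : HasDerivAt (fun r => - V s1 + ε * (r - s1)) ε x := by
      simpa using (((hasDerivAt_id x).sub_const s1).const_mul ε).const_add (- V s1)
    exact this.hasDerivWithinAt
  · intro x hx' he
    have h1 : ε * (x - s1) ≤ ε * (T - s1) := by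
      apply mul_le_mul_of_nonneg_left _ hε.le
      linarith [hx'.2]
    have := hD x (hsub1 x hx') (by linarith)
    linarith

end
end
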